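/- (Lemma 4.1.) If an approximate design P is φ1-universally optimal, then C(P) = Č(P) = n y* B_t/(t−1), where Č(P) = Č_{11}(P) − Č_{12}(P) W Č_{21}(P) with Č_{ij}(P) = n ∑_s p_s Č_{s,ij} and W any generalized inverse of Č_{22}(P). -/

import Mathlib

open Matrix Finset

noncomputable section

/-- `B^m_{i,j}`: the `i × j` real matrix whose upper-left `m × m` block is
`B_m = I_m − J_m/m` and whose remaining entries are `0`. -/
def Bblock (m i j : ℕ) : Matrix (Fin i) (Fin j) ℝ :=
  Matrix.of fun a b =>
    if (a : ℕ) < m ∧ (b : ℕ) < m then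
      (if (a : ℕ) = (b : ℕ) then 1 else 0) - 1 / (m : ℝ)
    else 0

/-- `B_k = I_k − J_k/k`. -/
def Bsq (k : ℕ) : Matrix (Fin k) (Fin k) ℝ := Bblock k k k

/-- Partial sums `a_{j,k} = ∑_{i=j}^k a_i`. -/
def aInt (a : ℕ → ℝ) (j k : ℕ) : ℝ := ∑ i ∈ Finset.Icc j k, a i

/-- `α_k = n⁻¹((n+1)a_k + a_{1,k−1}^{n+1} − a_{1,k}^{n+1})`. -/
def alphaCoef (n : ℕ) (a : ℕ → ℝ) (k : ℕ) : ℝ :=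
  (((n : ℝ) + 1) * a k + (aInt a 1 (k - 1)) ^ (n + 1) - (aInt a 1 k) ^ (n + 1)) / (n : ℝ)

/-- `β_k = a_k + a_{k+1,p} a_{1,k}^n − a_{k,p} a_{1,k−1}^n`. -/
def betaCoef (p n : ℕ) (a : ℕ → ℝ) (k : ℕ) : ℝ :=
  a k + aInt a (k + 1) p * (aInt a 1 k) ^ n - aInt a k p * (aInt a 1 (k - 1)) ^ n

/-- `A = ∑_{k=1}^p α_k B^k_p`. -/
def Amat (p n : ℕ) (a : ℕ → ℝ) : Matrix (Fin p) (Fin p) ℝ :=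
  ∑ k ∈ Finset.Icc 1 p, alphaCoef n a k • Bblock k p p

/-- `B = ∑_{k=1}^p β_k B^k_p`. -/
def Bmat (p n : ℕ) (a : ℕ → ℝ) : Matrix (Fin p) (Fin p) ℝ :=
  ∑ k ∈ Finset.Icc 1 p, betaCoef p n a k • Bblock k p p


/-- Treatment/period incidence matrix `T_s` of a treatment sequence `s`
(periods are indexed by `Fin p`, treatments by `Fin t`). -/
def Tmat {p t : ℕ} (s : Fin p → Fin t) : Matrix (Fin p) (Fin t) ℝ :=
  Matrix.of fun k i => if s k = i then 1 else 0

/-- Carryover incidence matrix `F_s`: `(F_s)_{k,i} = 1` iff `k ≥ 2` and the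
treatment in period `k − 1` is `i`. -/
def Fmat {p t : ℕ} (s : Fin p → Fin t) : Matrix (Fin p) (Fin t) ℝ :=
  Matrix.of fun k i =>
    if (k : ℕ) = 0 then 0
    else if s ⟨(k : ℕ) - 1, lt_of_le_of_lt (Nat.sub_le _ _) k.isLt⟩ = i then 1 else 0

/-- `T̂_s = T_s B_t`. -/
def That {p t : ℕ} (s : Fin p → Fin t) : Matrix (Fin p) (Fin t) ℝ := Tmat s * Bsq t

/-- `F̂_s = F_s B_t`. -/
def Fhat {p t : ℕ} (s : Fin p → Fin t) : Matrix (Fin p) (Fin t) ℝ := Fmat s * Bsq t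

/-- An approximate design: a probability vector indexed by all `t^p` sequences. -/
def IsDesign {p t : ℕ} (P : (Fin p → Fin t) → ℝ) : Prop :=
  (∀ s, 0 ≤ P s) ∧ ∑ s, P s = 1

/-- A design is symmetric if it is invariant under relabeling of treatments. -/
def IsSymmetricDesign {p t : ℕ} (P : (Fin p → Fin t) → ℝ) : Prop :=
  ∀ (σ : Equiv.Perm (Fin t)) (s : Fin p → Fin t), P (fun k => σ (s k)) = P s

/-- `T̄ = ∑_s p_s T_s`. -/
def Tbar {p t : ℕ} (P : (Fin p → Fin t) → ℝ) : Matrix (Fin p) (Fin t) ℝ :=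
  ∑ s, P s • Tmat s

/-- `F̄ = ∑_s p_s F_s`. -/
def Fbar {p t : ℕ} (P : (Fin p → Fin t) → ℝ) : Matrix (Fin p) (Fin t) ℝ :=
  ∑ s, P s • Fmat s

/-- `C₁₁(P) = n(∑_s p_s T_s' A T_s − T̄' B T̄)`. -/
def C11 (p t n : ℕ) (a : ℕ → ℝ) (P : (Fin p → Fin t) → ℝ) : Matrix (Fin t) (Fin t) ℝ :=
  (n : ℝ) • (∑ s, P s • ((Tmat s)ᵀ * Amat p n a * Tmat s) - (Tbar P)ᵀ * Bmat p n a * Tbar P)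

/-- `C₁₂(P) = n(∑_s p_s T_s' A F_s − T̄' B F̄)`. -/
def C12 (p t n : ℕ) (a : ℕ → ℝ) (P : (Fin p → Fin t) → ℝ) : Matrix (Fin t) (Fin t) ℝ :=
  (n : ℝ) • (∑ s, P s • ((Tmat s)ᵀ * Amat p n a * Fmat s) - (Tbar P)ᵀ * Bmat p n a * Fbar P)

/-- `C₂₂(P) = n(∑_s p_s F_s' A F_s − F̄' B F̄)`. -/
def C22 (p t n : ℕ) (a : ℕ → ℝ) (P : (Fin p → Fin t) → ℝ) : Matrix (Fin t) (Fin t) ℝ :=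
  (n : ℝ) • (∑ s, P s • ((Fmat s)ᵀ * Amat p n a * Fmat s) - (Fbar P)ᵀ * Bmat p n a * Fbar P)

/-- `W` is a generalized inverse of `C`. -/
def IsGInv {t : ℕ} (C W : Matrix (Fin t) (Fin t) ℝ) : Prop := C * W * C = C

/-- The information matrix `C(P) = C₁₁(P) − C₁₂(P) W C₂₁(P)`, computed with a
generalized inverse `W` of `C₂₂(P)` (its value does not depend on the choice). -/
def CInfo (p t n : ℕ) (a : ℕ → ℝ) (P : (Fin p → Fin t) → ℝ)
    (W : Matrix (Fin t) (Fin t) ℝ) : Matrix (Fin t) (Fin t) ℝ :=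
  C11 p t n a P - C12 p t n a P * W * (C12 p t n a P)ᵀ

/-- The `t × t` permutation matrix of a permutation `σ` of the treatments. -/
def permMat (t : ℕ) (σ : Equiv.Perm (Fin t)) : Matrix (Fin t) (Fin t) ℝ :=
  Matrix.of fun i j => if σ j = i then 1 else 0

/-- An optimality criterion: a real-valued function `Φ` on `t × t` real symmetric
matrices which is (C.1) concave, (C.2) invariant under simultaneous permutation of
rows and columns, and (C.3) nondecreasing under positive scaling of a positive
semidefinite matrix. -/
def IsCriterion (t : ℕ) (Φ : Matrix (Fin t) (Fin t) ℝ → ℝ) : Prop :=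
  (∀ lam : ℝ, 0 ≤ lam → lam ≤ 1 → ∀ M N : Matrix (Fin t) (Fin t) ℝ,
      M.IsHermitian → N.IsHermitian →
      lam * Φ M + (1 - lam) * Φ N ≤ Φ (lam • M + (1 - lam) • N)) ∧
  (∀ (σ : Equiv.Perm (Fin t)) (M : Matrix (Fin t) (Fin t) ℝ),
      Φ ((permMat t σ)ᵀ * M * permMat t σ) = Φ M) ∧
  (∀ M : Matrix (Fin t) (Fin t) ℝ, M.PosSemidef →
      ∀ b c : ℝ, 0 < b → b ≤ c → Φ (b • M) ≤ Φ (c • M))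

/-- `P` is φ₁-universally optimal: `Φ(C(P)) ≥ Φ(C(Q))` for every design `Q` and
every optimality criterion `Φ`. -/
def IsUnivOptimal (p t n : ℕ) (a : ℕ → ℝ) (P : (Fin p → Fin t) → ℝ) : Prop :=
  ∀ Φ : Matrix (Fin t) (Fin t) ℝ → ℝ, IsCriterion t Φ →
    ∀ Q : (Fin p → Fin t) → ℝ, IsDesign Q →
      ∀ WP WQ : Matrix (Fin t) (Fin t) ℝ,
        IsGInv (C22 p t n a P) WP → IsGInv (C22 p t n a Q) WQ →
          Φ (CInfo p t n a Q WQ) ≤ Φ (CInfo p t n a P WP)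

/-- `q_{s,11} = tr(B_t T_s' A T_s B_t)`. -/
def q11 (p t n : ℕ) (a : ℕ → ℝ) (s : Fin p → Fin t) : ℝ :=
  (Bsq t * (Tmat s)ᵀ * Amat p n a * Tmat s * Bsq t).trace

/-- `q_{s,12} = tr(B_t T_s' A F_s B_t)`. -/
def q12 (p t n : ℕ) (a : ℕ → ℝ) (s : Fin p → Fin t) : ℝ :=
  (Bsq t * (Tmat s)ᵀ * Amat p n a * Fmat s * Bsq t).trace

/-- `q_{s,22} = tr(B_t F_s' A F_s B_t)`. -/
def q22 (p t n : ℕ) (a : ℕ → ℝ) (s : Fin p → Fin t) : ℝ :=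
  (Bsq t * (Fmat s)ᵀ * Amat p n a * Fmat s * Bsq t).trace

/-- The quadratic `q_s(x) = q_{s,11} + 2 q_{s,12} x + q_{s,22} x²`. -/
def qfun (p t n : ℕ) (a : ℕ → ℝ) (s : Fin p → Fin t) (x : ℝ) : ℝ :=
  q11 p t n a s + 2 * q12 p t n a s * x + q22 p t n a s * x ^ 2

/-- `min_x ∑_s p_s q_s(x)`. -/
def qmin (p t n : ℕ) (a : ℕ → ℝ) (P : (Fin p → Fin t) → ℝ) : ℝ :=
  sInf (Set.range fun x : ℝ => ∑ s, P s * qfun p t n a s x)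

/-- `y* = max_P min_x ∑_s p_s q_s(x)`, the maximum over all approximate designs. -/
def ystar (p t n : ℕ) (a : ℕ → ℝ) : ℝ :=
  sSup {y : ℝ | ∃ P : (Fin p → Fin t) → ℝ, IsDesign P ∧ y = qmin p t n a P}

/-- `Č_{s,11} = T_s'(A−B)T_s + T̂_s' B T̂_s`. -/
def Cc11 (p t n : ℕ) (a : ℕ → ℝ) (s : Fin p → Fin t) : Matrix (Fin t) (Fin t) ℝ :=
  (Tmat s)ᵀ * (Amat p n a - Bmat p n a) * Tmat s + (That s)ᵀ * Bmat p n a * That s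

/-- `Č_{s,12} = T_s'(A−B)F_s + T̂_s' B F̂_s`. -/
def Cc12 (p t n : ℕ) (a : ℕ → ℝ) (s : Fin p → Fin t) : Matrix (Fin t) (Fin t) ℝ :=
  (Tmat s)ᵀ * (Amat p n a - Bmat p n a) * Fmat s + (That s)ᵀ * Bmat p n a * Fhat s

/-- `Č_{s,22} = F_s'(A−B)F_s + F̂_s' B F̂_s`. -/
def Cc22 (p t n : ℕ) (a : ℕ → ℝ) (s : Fin p → Fin t) : Matrix (Fin t) (Fin t) ℝ :=
  (Fmat s)ᵀ * (Amat p n a - Bmat p n a) * Fmat s + (Fhat s)ᵀ * Bmat p n a * Fhat s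

/-- `Č_{ij}(P) = n ∑_s p_s Č_{s,ij}` (the `(1,1)` block). -/
def Cc11D (p t n : ℕ) (a : ℕ → ℝ) (P : (Fin p → Fin t) → ℝ) : Matrix (Fin t) (Fin t) ℝ :=
  (n : ℝ) • ∑ s, P s • Cc11 p t n a s

/-- `Č_{12}(P) = n ∑_s p_s Č_{s,12}`. -/
def Cc12D (p t n : ℕ) (a : ℕ → ℝ) (P : (Fin p → Fin t) → ℝ) : Matrix (Fin t) (Fin t) ℝ :=
  (n : ℝ) • ∑ s, P s • Cc12 p t n a s

/-- `Č_{22}(P) = n ∑_s p_s Č_{s,22}`. -/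
def Cc22D (p t n : ℕ) (a : ℕ → ℝ) (P : (Fin p → Fin t) → ℝ) : Matrix (Fin t) (Fin t) ℝ :=
  (n : ℝ) • ∑ s, P s • Cc22 p t n a s

/-- `Č(P) = Č₁₁(P) − Č₁₂(P) W Č₂₁(P)` for a generalized inverse `W` of `Č₂₂(P)`. -/
def CcInfo (p t n : ℕ) (a : ℕ → ℝ) (P : (Fin p → Fin t) → ℝ)
    (W : Matrix (Fin t) (Fin t) ℝ) : Matrix (Fin t) (Fin t) ℝ :=
  Cc11D p t n a P - Cc12D p t n a P * W * (Cc12D p t n a P)ᵀ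

section LinearAlgebra

variable {ι : Type*} [Fintype ι]

/-- Every square matrix over a field has a generalized inverse. -/
lemma Matrix.exists_mul_mul_self_eq [DecidableEq ι] (C : Matrix ι ι ℝ) :
    ∃ W : Matrix ι ι ℝ, C * W * C = C := by
  obtain ⟨g, hg⟩ := C.toLin'.rangeRestrict.exists_rightInverse_of_surjective
    (LinearMap.range_rangeRestrict _)
  obtain ⟨w, hw⟩ := g.exists_extend
  refine ⟨LinearMap.toMatrix' w, ?_⟩
  apply Matrix.toLin'.injective
  ext1 x
  rw [Matrix.toLin'_mul, Matrix.toLin'_mul, Matrix.toLin'_toMatrix']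
  have h1 := LinearMap.congr_fun hw (C.toLin'.rangeRestrict (Pi.single x 1))
  have h2 := congrArg Subtype.val
    (LinearMap.congr_fun hg (C.toLin'.rangeRestrict (Pi.single x 1)))
  ext i
  simp only [LinearMap.comp_apply, LinearMap.single_apply] at h1 h2 ⊢
  have h3 := congrFun h2 i
  simp only [Submodule.subtype_apply] at h1
  rw [← h1] at h3
  simpa using h3

lemma Matrix.mul_eq_of_ker_le {C X W : Matrix ι ι ℝ}
    (hker : ∀ u, C *ᵥ u = 0 → X *ᵥ u = 0) (hW : C * W * C = C) : X * W * C = X := by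
  classical
  apply Matrix.toLin'.injective
  refine LinearMap.ext fun u => ?_
  have h : C *ᵥ (W *ᵥ C *ᵥ u - u) = 0 := by
    rw [mulVec_sub, mulVec_mulVec, mulVec_mulVec, hW, sub_self]
  have h' := hker _ h
  rw [mulVec_sub, sub_eq_zero, mulVec_mulVec, mulVec_mulVec] at h'
  simpa [Matrix.mul_assoc] using h'

lemma Matrix.mul_transpose_eq_of_ker_le {C X W : Matrix ι ι ℝ} (hC : Cᵀ = C)
    (hker : ∀ u, C *ᵥ u = 0 → X *ᵥ u = 0) (hW : C * W * C = C) : C * W * Xᵀ = Xᵀ := by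
  have hW' : C * Wᵀ * C = C := by
    have := congrArg transpose hW
    simpa [transpose_mul, hC, Matrix.mul_assoc] using this
  have := congrArg transpose (mul_eq_of_ker_le hker hW')
  simpa [transpose_mul, hC, Matrix.mul_assoc] using this

lemma Matrix.schur_transpose {C X Y W : Matrix ι ι ℝ} (hC : Cᵀ = C) (hY : Yᵀ = Y)
    (hker : ∀ u, C *ᵥ u = 0 → X *ᵥ u = 0) (hW : C * W * C = C) :
    (Y - X * W * Xᵀ)ᵀ = Y - X * W * Xᵀ := by
  have hW' : C * Wᵀ * C = C := by
    have := congrArg transpose hW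
    simpa [transpose_mul, hC, Matrix.mul_assoc] using this
  have h1 := mul_transpose_eq_of_ker_le hC hker hW
  have h2 := mul_eq_of_ker_le hker hW'
  have h3 : X * Wᵀ * Xᵀ = X * W * Xᵀ := by
    calc X * Wᵀ * Xᵀ = X * Wᵀ * (C * W * Xᵀ) := by rw [h1]
      _ = (X * Wᵀ * C) * W * Xᵀ := by simp only [Matrix.mul_assoc]
      _ = X * W * Xᵀ := by rw [h2]
  rw [transpose_sub, transpose_mul, transpose_mul, transpose_transpose, hY,
    ← Matrix.mul_assoc, h3]

lemma Matrix.dotProduct_mulVec_symm {ι κ : Type*} [Fintype ι] [Fintype κ]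
    (M : Matrix ι κ ℝ) (x : ι → ℝ) (y : κ → ℝ) :
    x ⬝ᵥ M *ᵥ y = y ⬝ᵥ Mᵀ *ᵥ x := by
  rw [dotProduct_mulVec, mulVec_transpose, dotProduct_comm]

lemma Matrix.quad_add {C : Matrix ι ι ℝ} (hC : Cᵀ = C) (x y : ι → ℝ) :
    (x + y) ⬝ᵥ C *ᵥ (x + y) = x ⬝ᵥ C *ᵥ x + 2 * (x ⬝ᵥ C *ᵥ y) + y ⬝ᵥ C *ᵥ y := by
  have h : y ⬝ᵥ C *ᵥ x = x ⬝ᵥ C *ᵥ y := by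
    rw [dotProduct_mulVec_symm, hC]
  rw [mulVec_add, dotProduct_add, add_dotProduct, add_dotProduct, h]
  ring

/-- Completing the square in a block quadratic form, with a generalized inverse. -/
lemma Matrix.block_quad_eq_schur {C X Y W : Matrix ι ι ℝ} (hC : Cᵀ = C)
    (hker : ∀ u, C *ᵥ u = 0 → X *ᵥ u = 0) (hW : C * W * C = C) (v u : ι → ℝ) :
    v ⬝ᵥ Y *ᵥ v + 2 * (v ⬝ᵥ X *ᵥ u) + u ⬝ᵥ C *ᵥ u =
      v ⬝ᵥ (Y - X * W * Xᵀ) *ᵥ v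
        + (u + W *ᵥ Xᵀ *ᵥ v) ⬝ᵥ C *ᵥ (u + W *ᵥ Xᵀ *ᵥ v) := by
  have h1 := mul_transpose_eq_of_ker_le hC hker hW
  have h2 : C *ᵥ W *ᵥ Xᵀ *ᵥ v = Xᵀ *ᵥ v := by
    rw [mulVec_mulVec, mulVec_mulVec, h1]
  have h3 : (W *ᵥ Xᵀ *ᵥ v) ⬝ᵥ Xᵀ *ᵥ v = v ⬝ᵥ (X * W * Xᵀ) *ᵥ v := by
    rw [dotProduct_mulVec_symm, transpose_transpose, mulVec_mulVec, mulVec_mulVec,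
      Matrix.mul_assoc]
  rw [quad_add hC, h2, h3, sub_mulVec, dotProduct_sub, dotProduct_mulVec_symm X v u]
  ring

/-- Saddle-point bound: if `C` is nonnegative on the `C`-orthogonal complement of `e`, then the
generalized Schur complement is bounded by the block form at a suitable translate along `e`. -/
lemma Matrix.exists_schur_le_block_quad {C X Y W : Matrix ι ι ℝ} (hC : Cᵀ = C)
    (hker : ∀ u, C *ᵥ u = 0 → X *ᵥ u = 0) (hW : C * W * C = C) (e : ι → ℝ)
    (hpos : ∀ x, e ⬝ᵥ C *ᵥ x = 0 → 0 ≤ x ⬝ᵥ C *ᵥ x)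
    (hdeg : e ⬝ᵥ C *ᵥ e = 0 → ∀ x, e ⬝ᵥ C *ᵥ x = 0) (v u : ι → ℝ) :
    ∃ c : ℝ, v ⬝ᵥ (Y - X * W * Xᵀ) *ᵥ v ≤
      v ⬝ᵥ Y *ᵥ v + 2 * (v ⬝ᵥ X *ᵥ (u + c • e)) + (u + c • e) ⬝ᵥ C *ᵥ (u + c • e) := by
  have key : ∃ c : ℝ, e ⬝ᵥ C *ᵥ (u + c • e + W *ᵥ Xᵀ *ᵥ v) = 0 := by
    by_cases h : e ⬝ᵥ C *ᵥ e = 0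
    · exact ⟨0, hdeg h _⟩
    · refine ⟨-(e ⬝ᵥ C *ᵥ (u + W *ᵥ Xᵀ *ᵥ v)) / (e ⬝ᵥ C *ᵥ e), ?_⟩
      rw [add_right_comm, mulVec_add, dotProduct_add, mulVec_smul, dotProduct_smul, smul_eq_mul]
      field_simp
      ring
  obtain ⟨c, hc⟩ := key
  refine ⟨c, ?_⟩
  rw [block_quad_eq_schur hC hker hW]
  linarith [hpos _ hc]

lemma Matrix.mulVec_eq_zero_of_quad_eq_zero {C : Matrix ι ι ℝ} (hC : Cᵀ = C)
    (hpos : ∀ x, 0 ≤ x ⬝ᵥ C *ᵥ x) {x : ι → ℝ} (hx : x ⬝ᵥ C *ᵥ x = 0) : C *ᵥ x = 0 := by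
  have hps : C.PosSemidef := PosSemidef.of_dotProduct_mulVec_nonneg
    (by rw [IsHermitian, conjTranspose_eq_transpose_of_trivial, hC]) (by simpa using hpos)
  exact (hps.dotProduct_mulVec_zero_iff x).1 (by simpa using hx)

lemma Matrix.eq_of_quad_le_of_trace_le [DecidableEq ι] {M N : Matrix ι ι ℝ}
    (hM : Mᵀ = M) (hN : Nᵀ = N)
    (hle : ∀ x, x ⬝ᵥ M *ᵥ x ≤ x ⬝ᵥ N *ᵥ x) (htr : N.trace ≤ M.trace) : N = M := by
  have hps : (N - M).PosSemidef := PosSemidef.of_dotProduct_mulVec_nonneg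
    (by rw [IsHermitian, conjTranspose_eq_transpose_of_trivial, transpose_sub, hM, hN])
    (fun x => by
      have := hle x
      simp only [star_trivial, sub_mulVec, dotProduct_sub]
      linarith)
  have h0 : (N - M).trace = 0 := by
    refine le_antisymm ?_ hps.trace_nonneg
    rw [trace_sub]; linarith
  exact sub_eq_zero.1 (hps.trace_eq_zero_iff.1 h0)

/-- The unit sphere of the space of vectors with zero coordinate sum. -/
def contrastSphere (ι : Type*) [Fintype ι] : Set (ι → ℝ) :=
  {y | ∑ i, y i = 0 ∧ ∑ i, y i ^ 2 = 1}

lemma isCompact_contrastSphere : IsCompact (contrastSphere ι) := by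
  refine Metric.isCompact_of_isClosed_isBounded ?_ ?_
  · exact (isClosed_eq (by fun_prop) continuous_const).inter
      (isClosed_eq (by fun_prop) continuous_const)
  · refine (Metric.isBounded_closedBall (x := (0 : ι → ℝ)) (r := 1)).subset fun y hy => ?_
    rw [mem_closedBall_zero_iff, pi_norm_le_iff_of_nonneg zero_le_one]
    intro i
    have h := Finset.single_le_sum (f := fun i => y i ^ 2) (fun i _ => sq_nonneg (y i))
      (Finset.mem_univ i)
    rw [hy.2] at h
    exact abs_le_one_iff_mul_self_le_one.2 (by nlinarith)

lemma exists_smul_mem_contrastSphere {y : ι → ℝ} (hy : ∑ i, y i = 0) (h0 : y ≠ 0) :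
    ∃ r : ℝ, 0 < r ∧ r • y ∈ contrastSphere ι ∧ r ^ 2 * ∑ i, y i ^ 2 = 1 := by
  have hpos : 0 < ∑ i, y i ^ 2 := by
    obtain ⟨i, hi⟩ := Function.ne_iff.1 h0
    exact Finset.sum_pos' (fun i _ => sq_nonneg _) ⟨i, Finset.mem_univ i, sq_pos_of_ne_zero hi⟩
  have hr : (√(∑ i, y i ^ 2))⁻¹ ^ 2 * ∑ i, y i ^ 2 = 1 := by
    rw [inv_pow, Real.sq_sqrt hpos.le, inv_mul_cancel₀ hpos.ne']
  refine ⟨(√(∑ i, y i ^ 2))⁻¹, by positivity, ⟨?_, ?_⟩, hr⟩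
  · simp [← Finset.mul_sum, hy]
  · simp only [Pi.smul_apply, smul_eq_mul, mul_pow, ← Finset.mul_sum, hr]

lemma Matrix.quad_smul (C : Matrix ι ι ℝ) (r : ℝ) (x : ι → ℝ) :
    (r • x) ⬝ᵥ C *ᵥ (r • x) = r ^ 2 * (x ⬝ᵥ C *ᵥ x) := by
  rw [mulVec_smul, dotProduct_smul, smul_dotProduct, smul_eq_mul, smul_eq_mul]
  ring

/-- Subtracting the mean from every coordinate. -/
def center (x : ι → ℝ) : ι → ℝ := x - ((∑ i, x i) / Fintype.card ι) • 1

lemma sum_center [Nonempty ι] (x : ι → ℝ) : ∑ i, center x i = 0 := by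
  have : (Fintype.card ι : ℝ) ≠ 0 := by exact_mod_cast Fintype.card_ne_zero
  simp only [center, Pi.sub_apply, Pi.smul_apply, Pi.one_apply, smul_eq_mul, mul_one,
    Finset.sum_sub_distrib, Finset.sum_const, Finset.card_univ, nsmul_eq_mul]
  field_simp
  ring

lemma Matrix.quad_center {C : Matrix ι ι ℝ} (hC : Cᵀ = C) (h1 : C *ᵥ 1 = 0) (x : ι → ℝ) :
    center x ⬝ᵥ C *ᵥ center x = x ⬝ᵥ C *ᵥ x := by
  have h2 : ∀ y, (1 : ι → ℝ) ⬝ᵥ C *ᵥ y = 0 := fun y => by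
    rw [dotProduct_mulVec_symm, hC, h1, dotProduct_zero]
  rw [center, mulVec_sub, mulVec_smul, h1, smul_zero, sub_zero, sub_dotProduct, smul_dotProduct,
    h2, smul_zero, sub_zero]

lemma Matrix.quad_nonneg_of_contrastSphere [Nonempty ι] {C : Matrix ι ι ℝ} (hC : Cᵀ = C)
    (h1 : C *ᵥ 1 = 0) (h : ∀ y ∈ contrastSphere ι, 0 ≤ y ⬝ᵥ C *ᵥ y) (x : ι → ℝ) :
    0 ≤ x ⬝ᵥ C *ᵥ x := by
  rw [← quad_center hC h1]
  by_cases h0 : center x = 0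
  · simp [h0]
  · obtain ⟨r, hr, hmem, -⟩ := exists_smul_mem_contrastSphere (sum_center x) h0
    have := h _ hmem
    rw [quad_smul] at this
    exact nonneg_of_mul_nonneg_right this (by positivity)

/-- Along a continuous path of symmetric matrices that annihilate constants, going from one that
is not positive semidefinite to one that is positive definite on contrasts, some matrix has a
nonzero contrast in its kernel. -/
lemma Matrix.exists_contrast_mem_ker [Nonempty ι] {K : ℝ → Matrix ι ι ℝ} (hK : Continuous K)
    (hsym : ∀ l, (K l)ᵀ = K l) (hone : ∀ l, K l *ᵥ 1 = 0) {x : ι → ℝ}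
    (hx : x ⬝ᵥ K 0 *ᵥ x < 0)
    (hpos : ∀ y, ∑ i, y i = 0 → y ≠ 0 → 0 < y ⬝ᵥ K 1 *ᵥ y) :
    ∃ l, 0 < l ∧ l ≤ 1 ∧ ∃ y : ι → ℝ, ∑ i, y i = 0 ∧ y ≠ 0 ∧ K l *ᵥ y = 0 := by
  let m : ℝ → ℝ := fun l => sInf ((fun y : ι → ℝ => y ⬝ᵥ K l *ᵥ y) '' contrastSphere ι)
  have hq : ∀ l, Continuous fun y : ι → ℝ => y ⬝ᵥ K l *ᵥ y := fun l => by fun_prop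
  have hm : Continuous m := isCompact_contrastSphere.continuous_sInf
    (f := fun l (y : ι → ℝ) => y ⬝ᵥ K l *ᵥ y) (by
      simp only [Function.HasUncurry.uncurry, id]
      exact continuous_snd.dotProduct ((hK.comp continuous_fst).matrix_mulVec continuous_snd))
  have hne : (contrastSphere ι).Nonempty := by
    have h0 : center x ≠ 0 := fun h => by
      rw [← quad_center (hsym 0) (hone 0), h] at hx
      simp at hx
    obtain ⟨r, -, hmem, -⟩ := exists_smul_mem_contrastSphere (sum_center x) h0
    exact ⟨_, hmem⟩
  have hmin : ∀ l, ∃ y ∈ contrastSphere ι, m l = y ⬝ᵥ K l *ᵥ y ∧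
      ∀ z ∈ contrastSphere ι, y ⬝ᵥ K l *ᵥ y ≤ z ⬝ᵥ K l *ᵥ z := fun l =>
    isCompact_contrastSphere.exists_sInf_image_eq_and_le hne (hq l).continuousOn
  have hne0 : ∀ y ∈ contrastSphere ι, y ≠ 0 := by
    rintro y hy rfl
    simpa using hy.2
  have hm0 : m 0 < 0 := by
    obtain ⟨y, hy, hmy, hle⟩ := hmin 0
    by_contra! h
    exact hx.not_ge (quad_nonneg_of_contrastSphere (hsym 0) (hone 0)
      (fun z hz => (hmy ▸ h).trans (hle z hz)) x)
  have hm1 : 0 ≤ m 1 := by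
    obtain ⟨y, hy, hmy, -⟩ := hmin 1
    rw [hmy]
    exact (hpos y hy.1 (hne0 y hy)).le
  obtain ⟨l, hl, hml⟩ := intermediate_value_Icc zero_le_one hm.continuousOn ⟨hm0.le, hm1⟩
  obtain ⟨y, hy, hmy, hle⟩ := hmin l
  rw [hml] at hmy
  refine ⟨l, lt_of_le_of_ne hl.1 ?_, hl.2, y, hy.1, hne0 y hy, ?_⟩
  · rintro rfl
    exact hm0.ne hml
  · exact mulVec_eq_zero_of_quad_eq_zero (hsym l) (quad_nonneg_of_contrastSphere (hsym l) (hone l)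
      fun z hz => hmy ▸ hle z hz) hmy.symm

/-- Nonnegative real quadratics attain their infimum. -/
lemma exists_quadratic_eq_sInf {c0 c1 c2 : ℝ} (hc2 : 0 ≤ c2)
    (h : ∀ x : ℝ, 0 ≤ c0 + c1 * x + c2 * x ^ 2) :
    ∃ x : ℝ, c0 + c1 * x + c2 * x ^ 2 =
      sInf (Set.range fun x : ℝ => c0 + c1 * x + c2 * x ^ 2) := by
  have key : ∃ x : ℝ, ∀ y : ℝ, c0 + c1 * x + c2 * x ^ 2 ≤ c0 + c1 * y + c2 * y ^ 2 := by
    rcases hc2.eq_or_lt with rfl | h2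
    · have h1 : c1 = 0 := by
        by_contra h1
        have h3 := h (-(c0 + 1) / c1)
        rw [mul_div_cancel₀ _ h1] at h3
        linarith
      exact ⟨0, fun y => by simp [h1]⟩
    · refine ⟨-c1 / (2 * c2), fun y => ?_⟩
      have : c0 + c1 * y + c2 * y ^ 2 - (c0 + c1 * (-c1 / (2 * c2)) + c2 * (-c1 / (2 * c2)) ^ 2)
          = c2 * (y + c1 / (2 * c2)) ^ 2 := by
        field_simp
        ring
      nlinarith [mul_nonneg hc2 (sq_nonneg (y + c1 / (2 * c2)))]
  obtain ⟨x, hx⟩ := key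
  have hleast : IsLeast (Set.range fun x : ℝ => c0 + c1 * x + c2 * x ^ 2)
      (c0 + c1 * x + c2 * x ^ 2) := ⟨⟨x, rfl⟩, by rintro _ ⟨y, rfl⟩; exact hx y⟩
  exact ⟨x, hleast.csInf_eq.symm⟩

end LinearAlgebra

section PeriodMatrices

/-- Sum of the first `k` coordinates. -/
def prefixSum {p : ℕ} (k : ℕ) (x : Fin p → ℝ) : ℝ := ∑ j : Fin p, if (j : ℕ) < k then x j else 0

lemma prefixSum_succ {p k : ℕ} (hk : k < p) (x : Fin p → ℝ) :
    prefixSum (k + 1) x = prefixSum k x + x ⟨k, hk⟩ := by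
  have h : x ⟨k, hk⟩ = ∑ j : Fin p, if j = ⟨k, hk⟩ then x j else 0 := by simp
  rw [prefixSum, prefixSum, h, ← Finset.sum_add_distrib]
  refine Finset.sum_congr rfl fun j _ => ?_
  rcases lt_trichotomy (j : ℕ) k with hj | hj | hj
  · simp [hj, hj.trans (Nat.lt_succ_self k), Fin.ext_iff, hj.ne]
  · simp [hj, Fin.ext_iff]
  · simp [hj.not_gt, Fin.ext_iff, hj.ne', hj.not_ge]

lemma prefixSum_zero {p : ℕ} (x : Fin p → ℝ) : prefixSum 0 x = 0 := by simp [prefixSum]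

lemma prefixSum_one {p k : ℕ} (hk : k ≤ p) : prefixSum k (1 : Fin p → ℝ) = k := by
  induction k with
  | zero => simp [prefixSum_zero]
  | succ k ih => rw [prefixSum_succ (by omega), ih (by omega)]; simp

lemma Bblock_mulVec {p : ℕ} (k : ℕ) (x : Fin p → ℝ) (i : Fin p) :
    (Bblock k p p *ᵥ x) i = if (i : ℕ) < k then x i - prefixSum k x / k else 0 := by
  simp only [mulVec, dotProduct, Bblock, Matrix.of_apply]
  by_cases hi : (i : ℕ) < k
  · have h : ∀ j : Fin p, (if (i : ℕ) < k ∧ (j : ℕ) < k then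
        ((if (i : ℕ) = j then (1 : ℝ) else 0) - 1 / (k : ℝ)) else 0) * x j =
        (if j = i then x j else 0) - (if (j : ℕ) < k then x j else 0) / k := fun j => by
      by_cases hj : (j : ℕ) < k
      · by_cases hij : j = i
        · subst hij; simp [hi]; ring
        · have : (i : ℕ) ≠ j := fun h => hij (Fin.ext h.symm)
          simp [hi, hj, hij, this]; ring
      · have : j ≠ i := fun h => hj (h ▸ hi)
        simp [hj, this]
    simp only [h, Finset.sum_sub_distrib, ← Finset.sum_div, if_pos hi, prefixSum]
    simp
  · simp [hi]

lemma Bblock_quad {p : ℕ} (k : ℕ) (x : Fin p → ℝ) :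
    x ⬝ᵥ Bblock k p p *ᵥ x = prefixSum k (fun i => x i ^ 2) - prefixSum k x ^ 2 / k := by
  have h : ∀ i : Fin p, x i * (Bblock k p p *ᵥ x) i =
      (if (i : ℕ) < k then x i ^ 2 else 0) - (if (i : ℕ) < k then x i else 0) *
        (prefixSum k x / k) := fun i => by
    rw [Bblock_mulVec]
    split_ifs <;> ring
  simp only [dotProduct, h, Finset.sum_sub_distrib, ← Finset.sum_mul]
  rw [← prefixSum, ← prefixSum]
  ring

lemma Bblock_transpose (k p : ℕ) : (Bblock k p p)ᵀ = Bblock k p p := by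
  ext i j
  simp only [Bblock, Matrix.transpose_apply, Matrix.of_apply]
  by_cases h : (i : ℕ) = j
  · simp [h]
  · simp [h, Ne.symm h, and_comm]

lemma Bblock_quad_le_succ {p k : ℕ} (hk : k < p) (x : Fin p → ℝ) :
    x ⬝ᵥ Bblock k p p *ᵥ x ≤ x ⬝ᵥ Bblock (k + 1) p p *ᵥ x := by
  rw [Bblock_quad, Bblock_quad, prefixSum_succ hk, prefixSum_succ hk]
  rcases Nat.eq_zero_or_pos k with rfl | hk0
  · simp [prefixSum_zero]
  · have hk' : (0 : ℝ) < k := by exact_mod_cast hk0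
    set S := prefixSum k x
    set z := x ⟨k, hk⟩
    have : z ^ 2 - (S + z) ^ 2 / ((k + 1 : ℕ) : ℝ) + S ^ 2 / k
        = (S - k * z) ^ 2 / (k * (k + 1)) := by
      push_cast
      field_simp
      ring
    have h2 : 0 ≤ (S - k * z) ^ 2 / (k * (k + 1)) := by positivity
    linarith

lemma Bblock_quad_mono {p j k : ℕ} (hjk : j ≤ k) (hk : k ≤ p) (x : Fin p → ℝ) :
    x ⬝ᵥ Bblock j p p *ᵥ x ≤ x ⬝ᵥ Bblock k p p *ᵥ x := by
  induction k, hjk using Nat.le_induction with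
  | base => exact le_rfl
  | succ k _ ih => exact (ih (by omega)).trans (Bblock_quad_le_succ hk x)

lemma Bblock_quad_nonneg {p k : ℕ} (hk : k ≤ p) (x : Fin p → ℝ) :
    0 ≤ x ⬝ᵥ Bblock k p p *ᵥ x := by
  have h := Bblock_quad_mono (Nat.zero_le k) hk x
  rwa [Bblock_quad 0, prefixSum_zero, prefixSum_zero, Nat.cast_zero, zero_pow two_ne_zero,
    zero_div, sub_zero] at h

lemma Bblock_mulVec_one {p k : ℕ} (hk : k ≤ p) : Bblock k p p *ᵥ 1 = 0 := by
  ext i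
  rw [Bblock_mulVec, prefixSum_one hk]
  split_ifs with h
  · have : (k : ℝ) ≠ 0 := by exact_mod_cast (Nat.zero_lt_of_lt h).ne'
    simp [this]
  · rfl

/-- The properties of the pair `(A, B)` of period matrices on which the optimality theory
rests. The index `m` is the last period carrying weight. -/
structure IsPeriodPair {p : ℕ} (A B : Matrix (Fin p) (Fin p) ℝ) (m : Fin p) (w : ℝ) : Prop where
  symm_left : Aᵀ = A
  symm_right : Bᵀ = B
  left_one : A *ᵥ 1 = 0
  right_one : B *ᵥ 1 = 0
  nonneg : ∀ x, 0 ≤ x ⬝ᵥ A *ᵥ x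
  le : ∀ x, x ⬝ᵥ A *ᵥ x ≤ x ⬝ᵥ B *ᵥ x
  ker_le : ∀ x, x ⬝ᵥ A *ᵥ x = 0 → B *ᵥ x = 0
  pos_index : 0 < (m : ℕ)
  pos_weight : 0 < w
  left_congr : ∀ x y : Fin p → ℝ, (∀ j ≤ m, x j = y j) → A *ᵥ x = A *ᵥ y
  right_congr : ∀ x y : Fin p → ℝ, (∀ j ≤ m, x j = y j) → B *ᵥ x = B *ᵥ y
  row : ∀ x : Fin p → ℝ, (A *ᵥ x) m = w * (x m - prefixSum (m + 1) x / ((m : ℕ) + 1 : ℕ))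

lemma pow_succ_sub_le {x y : ℝ} (hx : 0 ≤ x) (hxy : x ≤ y) (hy : y ≤ 1) (n : ℕ) :
    y ^ (n + 1) - x ^ (n + 1) ≤ (n + 1) * (y - x) := by
  induction n with
  | zero => simp
  | succ n ih =>
    have h1 : 0 ≤ y ^ (n + 1) - x ^ (n + 1) := sub_nonneg.2 (pow_le_pow_left₀ hx hxy _)
    have h2 : x ^ (n + 1) ≤ 1 := pow_le_one₀ hx (hxy.trans hy)
    push_cast
    have : y ^ (n + 1 + 1) - x ^ (n + 1 + 1) =
      y * (y ^ (n + 1) - x ^ (n + 1)) + x ^ (n + 1) * (y - x) := by ring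
    nlinarith

lemma pow_succ_sub_lt {x y : ℝ} (hx : 0 ≤ x) (hxy : x < y) (hy : y ≤ 1) {n : ℕ} (hn : 1 ≤ n) :
    y ^ (n + 1) - x ^ (n + 1) < (n + 1) * (y - x) := by
  obtain ⟨k, rfl⟩ : ∃ k, n = k + 1 := ⟨n - 1, by omega⟩
  have h1 : 0 ≤ y ^ (k + 1) - x ^ (k + 1) := sub_nonneg.2 (pow_le_pow_left₀ hx hxy.le _)
  have h2 : x ^ (k + 1) < 1 := pow_lt_one₀ hx (hxy.trans_le hy) (by omega)
  have h3 := pow_succ_sub_le hx hxy.le hy k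
  push_cast
  have : y ^ (k + 1 + 1) - x ^ (k + 1 + 1) =
    y * (y ^ (k + 1) - x ^ (k + 1)) + x ^ (k + 1) * (y - x) := by ring
  nlinarith

/-- The function `y - n y^n + (n-1) y^(n+1)` whose increments are `n (α_k - β_k)`. -/
def gapFun (n : ℕ) (y : ℝ) : ℝ := y - n * y ^ n + (n - 1) * y ^ (n + 1)

lemma gapFun_nonneg {n : ℕ} (hn : 1 ≤ n) {y : ℝ} (h0 : 0 ≤ y) (h1 : y ≤ 1) : 0 ≤ gapFun n y := by
  obtain ⟨k, rfl⟩ : ∃ k, n = k + 1 := ⟨n - 1, by omega⟩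
  have key : (k + 1) * y ^ k ≤ 1 + k * y ^ (k + 1) := by
    induction k with
    | zero => simp
    | succ k ih =>
      have h2 : y ^ (k + 1) ≤ 1 := pow_le_one₀ h0 h1
      have h3 := mul_le_mul_of_nonneg_left (ih (by omega)) h0
      push_cast
      rw [pow_succ y (k + 1)]
      rw [pow_succ] at h3 h2 ⊢
      nlinarith [mul_nonneg (sub_nonneg.2 h1) (sub_nonneg.2 h2)]
  have h2 := mul_le_mul_of_nonneg_left key h0
  rw [gapFun]
  push_cast
  rw [pow_succ y (k + 1)]
  rw [pow_succ] at h2 ⊢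
  nlinarith

lemma sum_sub_mul_ge {p : ℕ} {g φ : ℕ → ℝ} (hg0 : g 0 = 0) (hg : ∀ k ≤ p, 0 ≤ g k)
    (hφ : ∀ k < p, φ k ≤ φ (k + 1)) {N : ℕ} (hN : N ≤ p) :
    -(g N * φ N) ≤ ∑ k ∈ Finset.Icc 1 N, (g (k - 1) - g k) * φ k := by
  induction N with
  | zero => simp [hg0]
  | succ N ih =>
    rw [Finset.sum_Icc_succ_top (by omega), Nat.add_sub_cancel]
    have h1 := ih (by omega)
    have h2 := mul_le_mul_of_nonneg_left (hφ N (by omega)) (hg N (by omega))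
    linarith

section Weights

variable {p n : ℕ} {a : ℕ → ℝ}

lemma aInt_one_sub_one_add {k : ℕ} (hk : 1 ≤ k) : aInt a 1 k = aInt a 1 (k - 1) + a k := by
  obtain ⟨j, rfl⟩ : ∃ j, k = j + 1 := ⟨k - 1, by omega⟩
  simp [aInt, Finset.sum_Icc_succ_top]

lemma aInt_one_add_tail {k : ℕ} (hk : k ≤ p) : aInt a 1 k + aInt a (k + 1) p = aInt a 1 p := by
  simp only [aInt]
  have h := Finset.sum_Ioc_consecutive a (Nat.zero_le k) hk
  simpa [← Finset.Icc_add_one_left_eq_Ioc] using h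

lemma aInt_one_nonneg (ha0 : ∀ k ∈ Finset.Icc 1 p, 0 ≤ a k) {k : ℕ} (hk : k ≤ p) :
    0 ≤ aInt a 1 k :=
  Finset.sum_nonneg fun i hi => ha0 i (Finset.Icc_subset_Icc_right hk hi)

lemma aInt_one_le_one (ha0 : ∀ k ∈ Finset.Icc 1 p, 0 ≤ a k)
    (hsum : ∑ k ∈ Finset.Icc 1 p, a k = 1) {k : ℕ} (hk : k ≤ p) : aInt a 1 k ≤ 1 :=
  hsum ▸ Finset.sum_le_sum_of_subset_of_nonneg (Finset.Icc_subset_Icc_right hk)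
    fun i hi _ => ha0 i hi

lemma alphaCoef_nonneg (ha0 : ∀ k ∈ Finset.Icc 1 p, 0 ≤ a k)
    (hsum : ∑ k ∈ Finset.Icc 1 p, a k = 1) {k : ℕ} (hk : k ∈ Finset.Icc 1 p) :
    0 ≤ alphaCoef n a k := by
  obtain ⟨h1, h2⟩ := Finset.mem_Icc.1 hk
  have hs := aInt_one_sub_one_add (a := a) h1
  have := pow_succ_sub_le (aInt_one_nonneg ha0 (by omega : k - 1 ≤ p))
    (by linarith [ha0 k hk] : aInt a 1 (k - 1) ≤ aInt a 1 k) (aInt_one_le_one ha0 hsum h2) n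
  refine div_nonneg ?_ (Nat.cast_nonneg n)
  rw [show a k = aInt a 1 k - aInt a 1 (k - 1) by linarith]
  linarith

lemma alphaCoef_pos (hn : 1 ≤ n) (ha0 : ∀ k ∈ Finset.Icc 1 p, 0 ≤ a k)
    (hsum : ∑ k ∈ Finset.Icc 1 p, a k = 1) {k : ℕ} (hk : k ∈ Finset.Icc 1 p) (hak : 0 < a k) :
    0 < alphaCoef n a k := by
  obtain ⟨h1, h2⟩ := Finset.mem_Icc.1 hk
  have hs := aInt_one_sub_one_add (a := a) h1
  have := pow_succ_sub_lt (aInt_one_nonneg ha0 (by omega : k - 1 ≤ p))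
    (by linarith : aInt a 1 (k - 1) < aInt a 1 k) (aInt_one_le_one ha0 hsum h2) hn
  refine div_pos ?_ (by exact_mod_cast hn)
  rw [show a k = aInt a 1 k - aInt a 1 (k - 1) by linarith]
  linarith

lemma alphaCoef_eq_zero {k : ℕ} (hk : 1 ≤ k) (hak : a k = 0) : alphaCoef n a k = 0 := by
  have hs := aInt_one_sub_one_add (a := a) hk
  simp [alphaCoef, hs, hak]

lemma betaCoef_eq_zero {k : ℕ} (hk : k ∈ Finset.Icc 1 p) (hak : a k = 0) :
    betaCoef p n a k = 0 := by
  obtain ⟨h1, h2⟩ := Finset.mem_Icc.1 hk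
  have hs := aInt_one_sub_one_add (a := a) h1
  have h3 := aInt_one_add_tail (a := a) h2
  have h4 := aInt_one_add_tail (a := a) (show k - 1 ≤ p by omega)
  rw [Nat.sub_add_cancel h1] at h4
  rw [hak, add_zero] at hs
  have h5 : aInt a (k + 1) p = aInt a k p := by linarith
  rw [betaCoef, hak, hs, h5]
  ring

lemma betaCoef_sub_alphaCoef (hn : 1 ≤ n) (hsum : ∑ k ∈ Finset.Icc 1 p, a k = 1) {k : ℕ}
    (hk : k ∈ Finset.Icc 1 p) :
    n * (betaCoef p n a k - alphaCoef n a k) =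
      gapFun n (aInt a 1 (k - 1)) - gapFun n (aInt a 1 k) := by
  obtain ⟨h1, h2⟩ := Finset.mem_Icc.1 hk
  have hs := aInt_one_sub_one_add (a := a) h1
  have h3 := aInt_one_add_tail (a := a) h2
  have h4 := aInt_one_add_tail (a := a) (show k - 1 ≤ p by omega)
  rw [Nat.sub_add_cancel h1] at h4
  have h5 : aInt a 1 p = 1 := hsum
  have hn0 : (n : ℝ) ≠ 0 := by exact_mod_cast (by omega : n ≠ 0)
  rw [betaCoef, alphaCoef, gapFun, gapFun,
    show aInt a (k + 1) p = 1 - aInt a 1 k by linarith,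
    show aInt a k p = 1 - aInt a 1 (k - 1) by linarith,
    show a k = aInt a 1 k - aInt a 1 (k - 1) by linarith]
  field_simp
  ring

lemma sum_smul_Bblock_quad (c : ℕ → ℝ) (x y : Fin p → ℝ) :
    x ⬝ᵥ (∑ k ∈ Finset.Icc 1 p, c k • Bblock k p p) *ᵥ y =
      ∑ k ∈ Finset.Icc 1 p, c k * (x ⬝ᵥ Bblock k p p *ᵥ y) := by
  simp only [sum_mulVec, dotProduct_sum, smul_mulVec, dotProduct_smul, smul_eq_mul]

lemma sum_smul_Bblock_transpose (c : ℕ → ℝ) :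
    (∑ k ∈ Finset.Icc 1 p, c k • Bblock k p p)ᵀ = ∑ k ∈ Finset.Icc 1 p, c k • Bblock k p p := by
  simp only [transpose_sum, transpose_smul, Bblock_transpose]

lemma sum_smul_Bblock_mulVec_one (c : ℕ → ℝ) :
    (∑ k ∈ Finset.Icc 1 p, c k • Bblock k p p) *ᵥ 1 = 0 := by
  rw [sum_mulVec]
  refine Finset.sum_eq_zero fun k hk => ?_
  rw [smul_mulVec, Bblock_mulVec_one (Finset.mem_Icc.1 hk).2, smul_zero]

lemma sum_smul_Bblock_congr {c : ℕ → ℝ} {m : Fin p}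
    (hc : ∀ k ∈ Finset.Icc 1 p, (m : ℕ) + 1 < k → c k = 0) (x y : Fin p → ℝ)
    (hxy : ∀ j ≤ m, x j = y j) :
    (∑ k ∈ Finset.Icc 1 p, c k • Bblock k p p) *ᵥ x =
      (∑ k ∈ Finset.Icc 1 p, c k • Bblock k p p) *ᵥ y := by
  rw [sum_mulVec, sum_mulVec]
  refine Finset.sum_congr rfl fun k hk => ?_
  by_cases hkm : (m : ℕ) + 1 < k
  · simp [hc k hk hkm]
  · rw [smul_mulVec, smul_mulVec]
    congr 1
    have hj : ∀ j : Fin p, (j : ℕ) < k → x j = y j := fun j hj =>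
      hxy j (Fin.le_def.2 (by omega))
    ext i
    have hpre : prefixSum k x = prefixSum k y := Finset.sum_congr rfl fun j _ => by
      split_ifs with h
      · exact hj j h
      · rfl
    rw [Bblock_mulVec, Bblock_mulVec, hpre]
    split_ifs with h
    · rw [hj i h]
    · rfl

lemma Amat_quad_le_Bmat_quad (hn : 1 ≤ n) (ha0 : ∀ k ∈ Finset.Icc 1 p, 0 ≤ a k)
    (hsum : ∑ k ∈ Finset.Icc 1 p, a k = 1) (x : Fin p → ℝ) :
    x ⬝ᵥ Amat p n a *ᵥ x ≤ x ⬝ᵥ Bmat p n a *ᵥ x := by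
  have h := sum_sub_mul_ge (g := fun k => gapFun n (aInt a 1 k))
    (φ := fun k => x ⬝ᵥ Bblock k p p *ᵥ x) (p := p) (N := p)
    (by simp [gapFun, aInt, zero_pow (by omega : n ≠ 0)])
    (fun k hk => gapFun_nonneg hn (aInt_one_nonneg ha0 hk) (aInt_one_le_one ha0 hsum hk))
    (fun k hk => Bblock_quad_le_succ hk x) le_rfl
  have h1 : gapFun n (aInt a 1 p) = 0 := by
    rw [show aInt a 1 p = 1 from hsum]
    simp [gapFun]
  rw [h1, zero_mul, neg_zero] at h
  have h2 : ∑ k ∈ Finset.Icc 1 p, (gapFun n (aInt a 1 (k - 1)) - gapFun n (aInt a 1 k)) *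
      (x ⬝ᵥ Bblock k p p *ᵥ x) = n * (x ⬝ᵥ Bmat p n a *ᵥ x - x ⬝ᵥ Amat p n a *ᵥ x) := by
    rw [Bmat, Amat, sum_smul_Bblock_quad, sum_smul_Bblock_quad, ← Finset.sum_sub_distrib,
      Finset.mul_sum]
    refine Finset.sum_congr rfl fun k hk => ?_
    rw [← betaCoef_sub_alphaCoef hn hsum hk]
    ring
  rw [h2] at h
  have hn0 : (0 : ℝ) < n := by exact_mod_cast hn
  linarith [nonneg_of_mul_nonneg_right h hn0]

lemma exists_isPeriodPair (hn : 1 ≤ n) (ha0 : ∀ k ∈ Finset.Icc 1 p, 0 ≤ a k)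
    (hsum : ∑ k ∈ Finset.Icc 1 p, a k = 1) (hex : ∃ k ∈ Finset.Icc 2 p, 0 < a k) :
    ∃ m w, IsPeriodPair (Amat p n a) (Bmat p n a) m w := by
  classical
  obtain ⟨M, hM, hMmax⟩ := ((Finset.Icc 2 p).filter fun k => 0 < a k).exists_max_image id
    (by obtain ⟨k, hk, h⟩ := hex; exact ⟨k, Finset.mem_filter.2 ⟨hk, h⟩⟩)
  obtain ⟨hM1, haM⟩ := Finset.mem_filter.1 hM
  obtain ⟨hM2, hMp⟩ := Finset.mem_Icc.1 hM1
  have hMmem : M ∈ Finset.Icc 1 p := Finset.mem_Icc.2 ⟨by omega, hMp⟩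
  have hzero : ∀ k ∈ Finset.Icc 1 p, M < k → a k = 0 := fun k hk hkM => by
    refine le_antisymm (not_lt.1 fun h => ?_) (ha0 k hk)
    have := hMmax k (Finset.mem_filter.2
      ⟨Finset.mem_Icc.2 ⟨by omega, (Finset.mem_Icc.1 hk).2⟩, h⟩)
    simp only [id] at this
    omega
  have hα : ∀ k ∈ Finset.Icc 1 p, M < k → alphaCoef n a k = 0 := fun k hk h =>
    alphaCoef_eq_zero (Finset.mem_Icc.1 hk).1 (hzero k hk h)
  have hβ : ∀ k ∈ Finset.Icc 1 p, M < k → betaCoef p n a k = 0 := fun k hk h =>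
    betaCoef_eq_zero hk (hzero k hk h)
  have hw := alphaCoef_pos hn ha0 hsum hMmem haM
  have hterm : ∀ x : Fin p → ℝ, ∀ k ∈ Finset.Icc 1 p,
      0 ≤ alphaCoef n a k * (x ⬝ᵥ Bblock k p p *ᵥ x) := fun x k hk =>
    mul_nonneg (alphaCoef_nonneg ha0 hsum hk) (Bblock_quad_nonneg (Finset.mem_Icc.1 hk).2 x)
  have hM' : M - 1 + 1 = M := by omega
  refine ⟨⟨M - 1, by omega⟩, alphaCoef n a M, ?_⟩
  refine ⟨sum_smul_Bblock_transpose _, sum_smul_Bblock_transpose _, sum_smul_Bblock_mulVec_one _,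
    sum_smul_Bblock_mulVec_one _, fun x => ?_, Amat_quad_le_Bmat_quad hn ha0 hsum, fun x hx => ?_,
    ?_, hw, sum_smul_Bblock_congr ?_, sum_smul_Bblock_congr ?_, fun x => ?_⟩
  · rw [Amat, sum_smul_Bblock_quad]
    exact Finset.sum_nonneg (hterm x)
  · rw [Amat, sum_smul_Bblock_quad, Finset.sum_eq_zero_iff_of_nonneg (hterm x)] at hx
    have hxM := (mul_eq_zero.1 (hx M hMmem)).resolve_left hw.ne'
    rw [Bmat, sum_mulVec]
    refine Finset.sum_eq_zero fun k hk => ?_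
    have hkp := (Finset.mem_Icc.1 hk).2
    by_cases hkM : M < k
    · simp [hβ k hk hkM]
    · rw [smul_mulVec, mulVec_eq_zero_of_quad_eq_zero (Bblock_transpose k p)
        (Bblock_quad_nonneg hkp), smul_zero]
      exact le_antisymm (hxM ▸ Bblock_quad_mono (not_lt.1 hkM) hMp x) (Bblock_quad_nonneg hkp x)
  · simp only; omega
  · simpa only [hM'] using hα
  · simpa only [hM'] using hβ
  · simp only [hM']
    rw [Amat, sum_mulVec, Finset.sum_apply, Finset.sum_eq_single_of_mem M hMmem]
    · rw [smul_mulVec, Pi.smul_apply, smul_eq_mul, Bblock_mulVec,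
        if_pos (show M - 1 < M by omega)]
    · intro k hk hkM
      rw [smul_mulVec, Pi.smul_apply, smul_eq_mul, Bblock_mulVec]
      rcases lt_or_gt_of_ne hkM with h | h
      · rw [if_neg (show ¬ (M - 1 < k) by omega), mul_zero]
      · rw [hα k hk h, zero_mul]

end Weights

end PeriodMatrices

section Incidence

variable {p t : ℕ}

/-- The vector `(0, 1, …, 1)`. -/
def laterOnes (p : ℕ) : Fin p → ℝ := fun k => if (k : ℕ) = 0 then 0 else 1

lemma Tmat_mulVec (s : Fin p → Fin t) (x : Fin t → ℝ) (k : Fin p) :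
    (Tmat s *ᵥ x) k = x (s k) := by
  simp [Tmat, mulVec, dotProduct]

lemma Fmat_mulVec (s : Fin p → Fin t) (x : Fin t → ℝ) (k : Fin p) :
    (Fmat s *ᵥ x) k = if (k : ℕ) = 0 then 0 else
      x (s ⟨(k : ℕ) - 1, lt_of_le_of_lt (Nat.sub_le _ _) k.isLt⟩) := by
  by_cases h : (k : ℕ) = 0 <;> simp [Fmat, mulVec, dotProduct, h]

lemma Tmat_mulVec_one (s : Fin p → Fin t) : Tmat s *ᵥ 1 = 1 := by
  ext k; simp [Tmat_mulVec]

lemma Fmat_mulVec_one (s : Fin p → Fin t) : Fmat s *ᵥ 1 = laterOnes p := by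
  ext k; simp [Fmat_mulVec, laterOnes]

lemma Tbar_mulVec (P : (Fin p → Fin t) → ℝ) (x : Fin t → ℝ) :
    Tbar P *ᵥ x = ∑ s, P s • (Tmat s *ᵥ x) := by
  simp only [Tbar, sum_mulVec, smul_mulVec]

lemma Fbar_mulVec (P : (Fin p → Fin t) → ℝ) (x : Fin t → ℝ) :
    Fbar P *ᵥ x = ∑ s, P s • (Fmat s *ᵥ x) := by
  simp only [Fbar, sum_mulVec, smul_mulVec]

lemma Tbar_mulVec_one {P : (Fin p → Fin t) → ℝ} (hP : ∑ s, P s = 1) :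
    Tbar P *ᵥ 1 = 1 := by
  simp only [Tbar_mulVec, Tmat_mulVec_one, ← Finset.sum_smul, hP, one_smul]

lemma Fbar_mulVec_one {P : (Fin p → Fin t) → ℝ} (hP : ∑ s, P s = 1) :
    Fbar P *ᵥ 1 = laterOnes p := by
  simp only [Fbar_mulVec, Fmat_mulVec_one, ← Finset.sum_smul, hP, one_smul]

lemma Bsq_mulVec (x : Fin t → ℝ) : Bsq t *ᵥ x = center x := by
  ext i
  simp [Bsq, Bblock, mulVec, dotProduct, center, Fin.val_inj, sub_mul, Finset.sum_sub_distrib,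
    ← Finset.mul_sum]
  ring

lemma mul_Bsq_mulVec (X : Matrix (Fin p) (Fin t) ℝ) (x : Fin t → ℝ) :
    (X * Bsq t) *ᵥ x = X *ᵥ center x := by
  rw [← mulVec_mulVec, Bsq_mulVec]

lemma Bsq_transpose (t : ℕ) : (Bsq t)ᵀ = Bsq t := Bblock_transpose t t

lemma dotProduct_transpose_mul_mul_mulVec (X Y : Matrix (Fin p) (Fin t) ℝ)
    (M : Matrix (Fin p) (Fin p) ℝ) (v w : Fin t → ℝ) :
    v ⬝ᵥ (Xᵀ * M * Y) *ᵥ w = (X *ᵥ v) ⬝ᵥ M *ᵥ (Y *ᵥ w) := by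
  rw [← mulVec_mulVec, ← mulVec_mulVec, dotProduct_mulVec_symm, transpose_transpose,
    dotProduct_comm]

lemma dotProduct_sum_smul_mulVec (P : (Fin p → Fin t) → ℝ)
    (M : (Fin p → Fin t) → Matrix (Fin t) (Fin t) ℝ) (v w : Fin t → ℝ) :
    v ⬝ᵥ (∑ s, P s • M s) *ᵥ w = ∑ s, P s * (v ⬝ᵥ M s *ᵥ w) := by
  simp only [sum_mulVec, dotProduct_sum, smul_mulVec, dotProduct_smul, smul_eq_mul]

lemma dotProduct_C11_mulVec {n : ℕ} {a : ℕ → ℝ} (P : (Fin p → Fin t) → ℝ) (v w : Fin t → ℝ) :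
    v ⬝ᵥ C11 p t n a P *ᵥ w = n * (∑ s, P s * ((Tmat s *ᵥ v) ⬝ᵥ Amat p n a *ᵥ (Tmat s *ᵥ w))
      - (Tbar P *ᵥ v) ⬝ᵥ Bmat p n a *ᵥ (Tbar P *ᵥ w)) := by
  simp only [C11, smul_mulVec, dotProduct_smul, smul_eq_mul, sub_mulVec, dotProduct_sub,
    dotProduct_sum_smul_mulVec, dotProduct_transpose_mul_mul_mulVec]

lemma dotProduct_C12_mulVec {n : ℕ} {a : ℕ → ℝ} (P : (Fin p → Fin t) → ℝ) (v w : Fin t → ℝ) :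
    v ⬝ᵥ C12 p t n a P *ᵥ w = n * (∑ s, P s * ((Tmat s *ᵥ v) ⬝ᵥ Amat p n a *ᵥ (Fmat s *ᵥ w))
      - (Tbar P *ᵥ v) ⬝ᵥ Bmat p n a *ᵥ (Fbar P *ᵥ w)) := by
  simp only [C12, smul_mulVec, dotProduct_smul, smul_eq_mul, sub_mulVec, dotProduct_sub,
    dotProduct_sum_smul_mulVec, dotProduct_transpose_mul_mul_mulVec]

lemma dotProduct_C22_mulVec {n : ℕ} {a : ℕ → ℝ} (P : (Fin p → Fin t) → ℝ) (v w : Fin t → ℝ) :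
    v ⬝ᵥ C22 p t n a P *ᵥ w = n * (∑ s, P s * ((Fmat s *ᵥ v) ⬝ᵥ Amat p n a *ᵥ (Fmat s *ᵥ w))
      - (Fbar P *ᵥ v) ⬝ᵥ Bmat p n a *ᵥ (Fbar P *ᵥ w)) := by
  simp only [C22, smul_mulVec, dotProduct_smul, smul_eq_mul, sub_mulVec, dotProduct_sub,
    dotProduct_sum_smul_mulVec, dotProduct_transpose_mul_mul_mulVec]

lemma dotProduct_Cc11D_mulVec {n : ℕ} {a : ℕ → ℝ} (P : (Fin p → Fin t) → ℝ) (v w : Fin t → ℝ) :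
    v ⬝ᵥ Cc11D p t n a P *ᵥ w = n * ∑ s, P s *
      ((Tmat s *ᵥ v) ⬝ᵥ (Amat p n a - Bmat p n a) *ᵥ (Tmat s *ᵥ w)
        + (Tmat s *ᵥ center v) ⬝ᵥ Bmat p n a *ᵥ (Tmat s *ᵥ center w)) := by
  simp only [Cc11D, Cc11, That, smul_mulVec, dotProduct_smul, smul_eq_mul, add_mulVec,
    dotProduct_add, dotProduct_sum_smul_mulVec, dotProduct_transpose_mul_mul_mulVec,
    mul_Bsq_mulVec]

lemma dotProduct_Cc12D_mulVec {n : ℕ} {a : ℕ → ℝ} (P : (Fin p → Fin t) → ℝ) (v w : Fin t → ℝ) :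
    v ⬝ᵥ Cc12D p t n a P *ᵥ w = n * ∑ s, P s *
      ((Tmat s *ᵥ v) ⬝ᵥ (Amat p n a - Bmat p n a) *ᵥ (Fmat s *ᵥ w)
        + (Tmat s *ᵥ center v) ⬝ᵥ Bmat p n a *ᵥ (Fmat s *ᵥ center w)) := by
  simp only [Cc12D, Cc12, That, Fhat, smul_mulVec, dotProduct_smul, smul_eq_mul, add_mulVec,
    dotProduct_add, dotProduct_sum_smul_mulVec, dotProduct_transpose_mul_mul_mulVec,
    mul_Bsq_mulVec]

lemma dotProduct_Cc22D_mulVec {n : ℕ} {a : ℕ → ℝ} (P : (Fin p → Fin t) → ℝ) (v w : Fin t → ℝ) :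
    v ⬝ᵥ Cc22D p t n a P *ᵥ w = n * ∑ s, P s *
      ((Fmat s *ᵥ v) ⬝ᵥ (Amat p n a - Bmat p n a) *ᵥ (Fmat s *ᵥ w)
        + (Fmat s *ᵥ center v) ⬝ᵥ Bmat p n a *ᵥ (Fmat s *ᵥ center w)) := by
  simp only [Cc22D, Cc22, Fhat, smul_mulVec, dotProduct_smul, smul_eq_mul, add_mulVec,
    dotProduct_add, dotProduct_sum_smul_mulVec, dotProduct_transpose_mul_mul_mulVec,
    mul_Bsq_mulVec]

end Incidence

section PeriodPair

variable {p : ℕ} {A B : Matrix (Fin p) (Fin p) ℝ} {m : Fin p} {w : ℝ}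

lemma IsPeriodPair.symm_gap (h : IsPeriodPair A B m w) : (B - A)ᵀ = B - A := by
  rw [transpose_sub, h.symm_left, h.symm_right]

lemma IsPeriodPair.gap_nonneg (h : IsPeriodPair A B m w) (x : Fin p → ℝ) :
    0 ≤ x ⬝ᵥ (B - A) *ᵥ x := by
  rw [sub_mulVec, dotProduct_sub]
  exact sub_nonneg.2 (h.le x)

lemma IsPeriodPair.left_eq_zero (h : IsPeriodPair A B m w) {x : Fin p → ℝ}
    (hx : x ⬝ᵥ A *ᵥ x = 0) : A *ᵥ x = 0 :=
  mulVec_eq_zero_of_quad_eq_zero h.symm_left h.nonneg hx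

lemma IsPeriodPair.gap_eq_zero (h : IsPeriodPair A B m w) {x : Fin p → ℝ}
    (hx : x ⬝ᵥ (B - A) *ᵥ x = 0) : (B - A) *ᵥ x = 0 :=
  mulVec_eq_zero_of_quad_eq_zero h.symm_gap h.gap_nonneg hx

lemma IsPeriodPair.right_eq_zero (h : IsPeriodPair A B m w) {x : Fin p → ℝ}
    (hx : A *ᵥ x = 0) : B *ᵥ x = 0 :=
  h.ker_le x (by rw [hx, dotProduct_zero])

end PeriodPair

section Blocks

variable {p t n : ℕ} {a : ℕ → ℝ} {m : Fin p} {w : ℝ}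

/-- The vector of direct and carryover effects experienced along a treatment sequence. -/
def response (s : Fin p → Fin t) (v u : Fin t → ℝ) : Fin p → ℝ := Tmat s *ᵥ v + Fmat s *ᵥ u

/-- The mean of `response` under a design. -/
def meanResponse (P : (Fin p → Fin t) → ℝ) (v u : Fin t → ℝ) : Fin p → ℝ :=
  Tbar P *ᵥ v + Fbar P *ᵥ u

lemma meanResponse_eq (P : (Fin p → Fin t) → ℝ) (v u : Fin t → ℝ) :
    meanResponse P v u = ∑ s, P s • response s v u := by
  simp only [meanResponse, response, Tbar_mulVec, Fbar_mulVec, smul_add, Finset.sum_add_distrib]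

lemma response_add_const (s : Fin p → Fin t) (v u : Fin t → ℝ) (c : ℝ) :
    response s v (u + c • 1) = response s v u + c • laterOnes p := by
  rw [response, response, mulVec_add, mulVec_smul, Fmat_mulVec_one, add_assoc]

lemma meanResponse_add_const {P : (Fin p → Fin t) → ℝ} (hP : ∑ s, P s = 1)
    (v u : Fin t → ℝ) (c : ℝ) :
    meanResponse P v (u + c • 1) = meanResponse P v u + c • laterOnes p := by
  rw [meanResponse, meanResponse, mulVec_add, mulVec_smul, Fbar_mulVec_one hP, add_assoc]

lemma C11_transpose (h : IsPeriodPair (Amat p n a) (Bmat p n a) m w)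
    (P : (Fin p → Fin t) → ℝ) : (C11 p t n a P)ᵀ = C11 p t n a P := by
  simp only [C11, transpose_smul, transpose_sub, transpose_sum, transpose_mul, h.symm_left,
    h.symm_right, transpose_transpose, Matrix.mul_assoc]

lemma C22_transpose (h : IsPeriodPair (Amat p n a) (Bmat p n a) m w)
    (P : (Fin p → Fin t) → ℝ) : (C22 p t n a P)ᵀ = C22 p t n a P := by
  simp only [C22, transpose_smul, transpose_sub, transpose_sum, transpose_mul, h.symm_left,
    h.symm_right, transpose_transpose, Matrix.mul_assoc]

lemma Cc11D_transpose (h : IsPeriodPair (Amat p n a) (Bmat p n a) m w)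
    (P : (Fin p → Fin t) → ℝ) : (Cc11D p t n a P)ᵀ = Cc11D p t n a P := by
  simp only [Cc11D, Cc11, That, transpose_smul, transpose_sub, transpose_add, transpose_sum,
    transpose_mul, h.symm_left, h.symm_right, transpose_transpose, Matrix.mul_assoc]

lemma Cc22D_transpose (h : IsPeriodPair (Amat p n a) (Bmat p n a) m w)
    (P : (Fin p → Fin t) → ℝ) : (Cc22D p t n a P)ᵀ = Cc22D p t n a P := by
  simp only [Cc22D, Cc22, Fhat, transpose_smul, transpose_sub, transpose_add, transpose_sum,
    transpose_mul, h.symm_left, h.symm_right, transpose_transpose, Matrix.mul_assoc]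

lemma block_quad_eq (h : IsPeriodPair (Amat p n a) (Bmat p n a) m w)
    (P : (Fin p → Fin t) → ℝ) (v u : Fin t → ℝ) :
    v ⬝ᵥ C11 p t n a P *ᵥ v + 2 * (v ⬝ᵥ C12 p t n a P *ᵥ u) + u ⬝ᵥ C22 p t n a P *ᵥ u =
      n * (∑ s, P s * (response s v u ⬝ᵥ Amat p n a *ᵥ response s v u)
        - meanResponse P v u ⬝ᵥ Bmat p n a *ᵥ meanResponse P v u) := by
  simp only [response, meanResponse, quad_add h.symm_left, quad_add h.symm_right,
    dotProduct_C11_mulVec, dotProduct_C12_mulVec, dotProduct_C22_mulVec, mul_add,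
    Finset.sum_add_distrib, mul_left_comm _ (2 : ℝ), ← Finset.mul_sum]
  ring

lemma block_quad_hat_eq (h : IsPeriodPair (Amat p n a) (Bmat p n a) m w)
    (P : (Fin p → Fin t) → ℝ) (v u : Fin t → ℝ) :
    v ⬝ᵥ Cc11D p t n a P *ᵥ v + 2 * (v ⬝ᵥ Cc12D p t n a P *ᵥ u) + u ⬝ᵥ Cc22D p t n a P *ᵥ u =
      n * ∑ s, P s * (response s v u ⬝ᵥ (Amat p n a - Bmat p n a) *ᵥ response s v u
        + response s (center v) (center u) ⬝ᵥ
          Bmat p n a *ᵥ response s (center v) (center u)) := by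
  have hD : (Amat p n a - Bmat p n a)ᵀ = Amat p n a - Bmat p n a := by
    rw [transpose_sub, h.symm_left, h.symm_right]
  simp only [response, quad_add hD, quad_add h.symm_right,
    dotProduct_Cc11D_mulVec, dotProduct_Cc12D_mulVec, dotProduct_Cc22D_mulVec, mul_add,
    Finset.sum_add_distrib, mul_left_comm _ (2 : ℝ), ← Finset.mul_sum]
  ring

lemma one_dotProduct_C22 {P : (Fin p → Fin t) → ℝ} (hP : ∑ s, P s = 1) (x : Fin t → ℝ) :
    1 ⬝ᵥ C22 p t n a P *ᵥ x =
      - (n * (laterOnes p ⬝ᵥ (Bmat p n a - Amat p n a) *ᵥ (Fbar P *ᵥ x))) := by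
  rw [dotProduct_C22_mulVec, Fbar_mulVec_one hP]
  have : ∑ s, P s * ((Fmat s *ᵥ (1 : Fin t → ℝ)) ⬝ᵥ Amat p n a *ᵥ (Fmat s *ᵥ x)) =
      laterOnes p ⬝ᵥ Amat p n a *ᵥ (Fbar P *ᵥ x) := by
    simp only [Fmat_mulVec_one, Fbar_mulVec, mulVec_sum, dotProduct_sum, mulVec_smul,
      dotProduct_smul, smul_eq_mul]
  rw [this, sub_mulVec, dotProduct_sub]
  ring

lemma C11_mulVec_one (h : IsPeriodPair (Amat p n a) (Bmat p n a) m w)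
    {P : (Fin p → Fin t) → ℝ} (hP : ∑ s, P s = 1) : C11 p t n a P *ᵥ 1 = 0 := by
  refine dotProduct_eq _ _ fun x => ?_
  rw [dotProduct_comm, dotProduct_C11_mulVec, Tbar_mulVec_one hP]
  simp [Tmat_mulVec_one, h.left_one, h.right_one]

lemma C12_transpose_mulVec_one (h : IsPeriodPair (Amat p n a) (Bmat p n a) m w)
    {P : (Fin p → Fin t) → ℝ} (hP : ∑ s, P s = 1) : (C12 p t n a P)ᵀ *ᵥ 1 = 0 := by
  refine dotProduct_eq _ _ fun x => ?_
  have hA : ∀ y, (1 : Fin p → ℝ) ⬝ᵥ Amat p n a *ᵥ y = 0 := fun y => by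
    rw [dotProduct_mulVec_symm, h.symm_left, h.left_one, dotProduct_zero]
  have hB : ∀ y, (1 : Fin p → ℝ) ⬝ᵥ Bmat p n a *ᵥ y = 0 := fun y => by
    rw [dotProduct_mulVec_symm, h.symm_right, h.right_one, dotProduct_zero]
  rw [dotProduct_comm, ← dotProduct_mulVec_symm, dotProduct_C12_mulVec, Tbar_mulVec_one hP]
  simp only [Tmat_mulVec_one, hA, hB, mul_zero, Finset.sum_const_zero, sub_zero, zero_dotProduct]

end Blocks

section RangeCondition

variable {p t n : ℕ} {a : ℕ → ℝ} {m : Fin p} {w : ℝ}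

lemma permMat_conj (σ : Equiv.Perm (Fin t)) (M : Matrix (Fin t) (Fin t) ℝ) :
    (permMat t σ)ᵀ * M * permMat t σ = M.submatrix σ σ := by
  ext i j
  simp [permMat, Matrix.mul_apply]

lemma isCriterion_trace (t : ℕ) : IsCriterion t Matrix.trace := by
  refine ⟨fun l _ _ M N _ _ => ?_, fun σ M => ?_, fun M hM b c _ hbc => ?_⟩
  · simp [trace_add, trace_smul]
  · rw [permMat_conj]
    exact Equiv.sum_comp σ fun i => M i i
  · rw [trace_smul, trace_smul, smul_eq_mul, smul_eq_mul]
    exact mul_le_mul_of_nonneg_right hbc hM.trace_nonneg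

/-- Every design satisfies the range condition when some design is universally optimal: otherwise
the trace of `C₁₁ − C₁₂ W C₂₁` would be unbounded over generalized inverses `W`. -/
lemma IsUnivOptimal.ker_le {P Q : (Fin p → Fin t) → ℝ} (hopt : IsUnivOptimal p t n a P) (hQ : IsDesign Q)
    {u : Fin t → ℝ} (hu : C22 p t n a Q *ᵥ u = 0) : C12 p t n a Q *ᵥ u = 0 := by
  obtain ⟨WP, hWP⟩ := exists_mul_mul_self_eq (C22 p t n a P)
  obtain ⟨W, hW⟩ := exists_mul_mul_self_eq (C22 p t n a Q)
  by_contra hne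
  have hpos : 0 < C12 p t n a Q *ᵥ u ⬝ᵥ C12 p t n a Q *ᵥ u :=
    lt_of_le_of_ne (by simpa using dotProduct_star_self_nonneg (C12 p t n a Q *ᵥ u))
      (fun h0 => hne (dotProduct_self_eq_zero.1 h0.symm))
  set r := C12 p t n a Q *ᵥ u ⬝ᵥ C12 p t n a Q *ᵥ u
  have key : ∀ l : ℝ, (CInfo p t n a Q W).trace - l * r ≤ (CInfo p t n a P WP).trace := by
    intro l
    have hG : IsGInv (C22 p t n a Q) (W + l • vecMulVec u u) := by
      rw [IsGInv, Matrix.mul_add, Matrix.add_mul, hW, Matrix.mul_smul, mul_vecMulVec, hu,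
        zero_vecMulVec, smul_zero, Matrix.zero_mul, add_zero]
    have := hopt _ (isCriterion_trace t) Q hQ WP _ hWP hG
    refine le_trans (le_of_eq ?_) this
    rw [CInfo, CInfo, Matrix.mul_add, Matrix.add_mul, Matrix.mul_smul, mul_vecMulVec,
      Matrix.smul_mul, vecMulVec_mul, vecMul_transpose, ← sub_sub, trace_sub, trace_sub _ (l • _),
      trace_smul, trace_vecMulVec, smul_eq_mul]
    simp only [trace_sub]
    rfl
  have := key (((CInfo p t n a Q W).trace - (CInfo p t n a P WP).trace - 1) / r)
  rw [div_mul_cancel₀ _ hpos.ne'] at this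
  linarith

/-- A carryover vector is constant if `A F_s u` has the same `m`-th entry for all sequences. -/
lemma IsPeriodPair.const_of_row (h : IsPeriodPair (Amat p n a) (Bmat p n a) m w)
    {u : Fin t → ℝ}
    (hu : ∀ s s' : Fin p → Fin t,
      (Amat p n a *ᵥ (Fmat s *ᵥ u)) m = (Amat p n a *ᵥ (Fmat s' *ᵥ u)) m) (i j : Fin t) :
    u i = u j := by
  have hm := h.pos_index
  let k : Fin p := ⟨(m : ℕ) - 1, lt_of_le_of_lt (Nat.sub_le _ _) m.isLt⟩
  let s : Fin p → Fin t := fun _ => j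
  let s' : Fin p → Fin t := Function.update s k i
  have hs : Fmat s' *ᵥ u = Fmat s *ᵥ u + Pi.single m (u i - u j) := by
    ext l
    rw [Pi.add_apply, Fmat_mulVec, Fmat_mulVec]
    by_cases hlm : l = m
    · subst hlm
      have : s' k = i := Function.update_self ..
      rw [if_neg hm.ne', if_neg hm.ne', Pi.single_eq_same]
      change u (s' k) = u j + _
      rw [this]
      ring
    · rw [Pi.single_eq_of_ne hlm, add_zero]
      by_cases hl : (l : ℕ) = 0
      · rw [if_pos hl, if_pos hl]
      · rw [if_neg hl, if_neg hl]
        have : s' ⟨(l : ℕ) - 1, lt_of_le_of_lt (Nat.sub_le _ _) l.isLt⟩ = j := by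
          refine Function.update_of_ne (fun he => hlm (Fin.ext ?_)) _ _
          have := congrArg Fin.val he
          simp only [k] at this
          omega
        rw [this]
  have h1 := hu s' s
  rw [hs, mulVec_add, Pi.add_apply, add_eq_left, h.row] at h1
  have h2 : prefixSum ((m : ℕ) + 1) (Pi.single m (u i - u j) : Fin p → ℝ) = u i - u j := by
    rw [prefixSum, Finset.sum_eq_single m]
    · simp
    · intro b _ hb
      simp [Pi.single_eq_of_ne hb]
    · simp
  rw [h2, Pi.single_eq_same] at h1
  have hm1 : (1 : ℝ) ≤ (m : ℕ) := by exact_mod_cast hm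
  have h3 : u i - u j - (u i - u j) / (((m : ℕ) + 1 : ℕ) : ℝ) = 0 :=
    (mul_eq_zero.1 h1).resolve_left h.pos_weight.ne'
  push_cast at h3
  have h4 : (u i - u j) * (m : ℕ) = 0 := by
    field_simp at h3
    linarith
  exact sub_eq_zero.1 ((mul_eq_zero.1 h4).resolve_right (by positivity))

end RangeCondition

section CarryoverBlock

variable {p t n : ℕ} {a : ℕ → ℝ} {m : Fin p} {w : ℝ}

/-- Move the weight which `Q` puts on `s` to `s'`. -/
def moveWeight (Q : (Fin p → Fin t) → ℝ) (s s' : Fin p → Fin t) : (Fin p → Fin t) → ℝ :=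
  Q + Q s • (Pi.single s' 1 - Pi.single s 1)

lemma sum_moveWeight_smul {E : Type*} [AddCommGroup E] [Module ℝ E] (Q : (Fin p → Fin t) → ℝ)
    (s s' : Fin p → Fin t) (g : (Fin p → Fin t) → E) :
    ∑ r, moveWeight Q s s' r • g r = ∑ r, Q r • g r + Q s • (g s' - g s) := by
  have h1 : ∀ q, ∑ r, (Pi.single q 1 : (Fin p → Fin t) → ℝ) r • g r = g q := fun q => by
    rw [Finset.sum_eq_single q (fun b _ hb => by rw [Pi.single_eq_of_ne hb, zero_smul]) (by simp),
      Pi.single_eq_same, one_smul]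
  simp only [moveWeight, Pi.add_apply, Pi.smul_apply, Pi.sub_apply, add_smul, sub_smul, smul_assoc,
    Finset.sum_add_distrib, Finset.sum_sub_distrib, ← Finset.smul_sum, h1]

lemma sum_moveWeight_mul (Q : (Fin p → Fin t) → ℝ) (s s' : Fin p → Fin t)
    (g : (Fin p → Fin t) → ℝ) :
    ∑ r, moveWeight Q s s' r * g r = ∑ r, Q r * g r + Q s * (g s' - g s) :=
  sum_moveWeight_smul Q s s' g

lemma IsDesign.moveWeight {Q : (Fin p → Fin t) → ℝ} (hQ : IsDesign Q) (s s' : Fin p → Fin t) :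
    IsDesign (moveWeight Q s s') := by
  refine ⟨fun r => ?_, ?_⟩
  · have h1 := hQ.1 r
    have h2 := hQ.1 s
    simp only [_root_.moveWeight, Pi.add_apply, Pi.smul_apply, Pi.sub_apply, smul_eq_mul,
      Pi.single_apply]
    split_ifs with h3 h4 h4 <;> first | (subst h4; linarith) | linarith
  · have := sum_moveWeight_mul Q s s' (fun _ => 1)
    simpa [hQ.2] using this

lemma IsUnivOptimal.const_of_ker (ht : 2 ≤ t) (hn : 1 ≤ n)
    (h : IsPeriodPair (Amat p n a) (Bmat p n a) m w)
    {P Q : (Fin p → Fin t) → ℝ} (hopt : IsUnivOptimal p t n a P) (hQ : IsDesign Q)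
    (hfull : ∀ s, 0 < Q s) {u : Fin t → ℝ} (hu : C22 p t n a Q *ᵥ u = 0) (i j : Fin t) :
    u i = u j := by
  have hn0 : (n : ℝ) ≠ 0 := by positivity
  suffices H : ∀ s, (Amat p n a *ᵥ (Fmat s *ᵥ u)) m = (Bmat p n a *ᵥ (Fbar Q *ᵥ u)) m from
    h.const_of_row (fun s s' => (H s).trans (H s').symm) i j
  intro s
  obtain ⟨j, hj⟩ : ∃ j : Fin t, j ≠ s m := by
    have : Nontrivial (Fin t) := Fin.nontrivial_iff_two_le.2 ht
    exact exists_ne _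
  let s' := Function.update s m j
  have hagree : ∀ x : Fin t → ℝ, ∀ k ≤ m, (Fmat s' *ᵥ x) k = (Fmat s *ᵥ x) k := by
    intro x k hk
    rw [Fmat_mulVec, Fmat_mulVec]
    split_ifs with h0
    · rfl
    · congr 1
      refine Function.update_of_ne (fun he => ?_) _ _
      have := congrArg Fin.val he
      have hk' : (k : ℕ) ≤ m := hk
      simp only at this
      omega
  have hA : ∀ x : Fin t → ℝ, Amat p n a *ᵥ (Fmat s' *ᵥ x) = Amat p n a *ᵥ (Fmat s *ᵥ x) :=
    fun x => h.left_congr _ _ (hagree x)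
  have hB : ∀ x : Fin t → ℝ, Bmat p n a *ᵥ (Fbar (moveWeight Q s s') *ᵥ x) =
      Bmat p n a *ᵥ (Fbar Q *ᵥ x) := fun x => by
    rw [Fbar_mulVec, sum_moveWeight_smul, ← Fbar_mulVec, mulVec_add, mulVec_smul, mulVec_sub,
      h.right_congr _ _ (hagree x), sub_self, smul_zero, add_zero]
  have hAsymm : ∀ x y, x ⬝ᵥ Amat p n a *ᵥ y = y ⬝ᵥ Amat p n a *ᵥ x := fun x y => by
    rw [dotProduct_mulVec_symm, h.symm_left]
  have hBsymm : ∀ x y, x ⬝ᵥ Bmat p n a *ᵥ y = y ⬝ᵥ Bmat p n a *ᵥ x := fun x y => by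
    rw [dotProduct_mulVec_symm, h.symm_right]
  have hu' : C22 p t n a (moveWeight Q s s') *ᵥ u = 0 := by
    rw [← hu]
    refine dotProduct_eq _ _ fun x => ?_
    rw [dotProduct_comm, dotProduct_comm _ x, dotProduct_C22_mulVec, dotProduct_C22_mulVec,
      sum_moveWeight_mul, hB, hA, hBsymm, hB, hBsymm (_ : Fin p → ℝ) (Fbar Q *ᵥ u),
      hAsymm, hA, hAsymm, sub_self, mul_zero, add_zero]
  have h1 := congrArg (Pi.single j 1 ⬝ᵥ ·) (hopt.ker_le hQ hu)
  have h2 := congrArg (Pi.single j 1 ⬝ᵥ ·) (hopt.ker_le (hQ.moveWeight s s') hu')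
  have hT : Tmat s' *ᵥ Pi.single j 1 = Tmat s *ᵥ Pi.single j 1 + Pi.single m 1 := by
    ext k
    rw [Pi.add_apply, Tmat_mulVec, Tmat_mulVec]
    by_cases hk : k = m
    · subst hk
      have : s' k = j := Function.update_self ..
      rw [this, Pi.single_eq_same, Pi.single_eq_same, Pi.single_eq_of_ne hj.symm, zero_add]
    · have : s' k = s k := Function.update_of_ne hk _ _
      rw [this, Pi.single_eq_of_ne hk, add_zero]
  simp only [dotProduct_zero, dotProduct_C12_mulVec, sum_moveWeight_mul, hB, hA, hT,
    mul_eq_zero, hn0, false_or, add_dotProduct] at h1 h2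
  rw [Tbar_mulVec, sum_moveWeight_smul, ← Tbar_mulVec, hT, add_dotProduct,
    smul_dotProduct, smul_eq_mul] at h2
  simp only [add_sub_cancel_left, single_one_dotProduct] at h2
  have h3 : Q s * ((Amat p n a *ᵥ (Fmat s *ᵥ u)) m - (Bmat p n a *ᵥ (Fbar Q *ᵥ u)) m) = 0 := by
    linear_combination h2 - h1
  exact sub_eq_zero.1 ((mul_eq_zero.1 h3).resolve_left (hfull s).ne')

end CarryoverBlock

section Definiteness

variable {p t n : ℕ} {a : ℕ → ℝ} {m : Fin p} {w : ℝ}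

/-- The vector `b` with `1' C₂₂ x = -n b' x`. -/
def gapVec (p t n : ℕ) (a : ℕ → ℝ) (P : (Fin p → Fin t) → ℝ) : Fin t → ℝ :=
  (Fbar P)ᵀ *ᵥ ((Bmat p n a - Amat p n a) *ᵥ laterOnes p)

/-- The scalar `e' (B - A) e` for `e = (0, 1, …, 1)`. -/
def gapNorm (p n : ℕ) (a : ℕ → ℝ) : ℝ :=
  laterOnes p ⬝ᵥ (Bmat p n a - Amat p n a) *ᵥ laterOnes p

/-- The matrix `C₂₂` with the direction `1` projected out. -/
def reducedC22 (p t n : ℕ) (a : ℕ → ℝ) (P : (Fin p → Fin t) → ℝ) : Matrix (Fin t) (Fin t) ℝ :=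
  C22 p t n a P + (n * (gapNorm p n a)⁻¹ : ℝ) • vecMulVec (gapVec p t n a P) (gapVec p t n a P)

lemma gapVec_dotProduct (h : IsPeriodPair (Amat p n a) (Bmat p n a) m w)
    (P : (Fin p → Fin t) → ℝ) (x : Fin t → ℝ) :
    gapVec p t n a P ⬝ᵥ x = laterOnes p ⬝ᵥ (Bmat p n a - Amat p n a) *ᵥ (Fbar P *ᵥ x) := by
  rw [gapVec, dotProduct_comm, ← dotProduct_mulVec_symm, dotProduct_comm, dotProduct_mulVec_symm,
    h.symm_gap, dotProduct_comm]

lemma gapVec_dotProduct_one (h : IsPeriodPair (Amat p n a) (Bmat p n a) m w)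
    {P : (Fin p → Fin t) → ℝ} (hP : ∑ s, P s = 1) :
    gapVec p t n a P ⬝ᵥ 1 = gapNorm p n a := by
  rw [gapVec_dotProduct h, Fbar_mulVec_one hP, gapNorm]

lemma C22_mulVec_one (h : IsPeriodPair (Amat p n a) (Bmat p n a) m w)
    {P : (Fin p → Fin t) → ℝ} (hP : ∑ s, P s = 1) :
    C22 p t n a P *ᵥ 1 = -((n : ℝ) • gapVec p t n a P) := by
  refine dotProduct_eq _ _ fun x => ?_
  rw [dotProduct_comm, dotProduct_mulVec_symm, C22_transpose h, one_dotProduct_C22 hP,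
    neg_dotProduct, smul_dotProduct, gapVec_dotProduct h, smul_eq_mul]

lemma gapVec_eq_zero (h : IsPeriodPair (Amat p n a) (Bmat p n a) m w) (h0 : gapNorm p n a = 0)
    (P : (Fin p → Fin t) → ℝ) : gapVec p t n a P = 0 := by
  rw [gapVec, h.gap_eq_zero h0, mulVec_zero]

lemma reducedC22_transpose (h : IsPeriodPair (Amat p n a) (Bmat p n a) m w)
    (P : (Fin p → Fin t) → ℝ) : (reducedC22 p t n a P)ᵀ = reducedC22 p t n a P := by
  rw [reducedC22, transpose_add, transpose_smul, transpose_vecMulVec, C22_transpose h]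

lemma reducedC22_mulVec (P : (Fin p → Fin t) → ℝ) (x : Fin t → ℝ) :
    reducedC22 p t n a P *ᵥ x = C22 p t n a P *ᵥ x +
      (n * (gapNorm p n a)⁻¹ * (gapVec p t n a P ⬝ᵥ x)) • gapVec p t n a P := by
  rw [reducedC22, add_mulVec, smul_mulVec, vecMulVec_mulVec, op_smul_eq_smul, smul_smul]

lemma reducedC22_mulVec_one (h : IsPeriodPair (Amat p n a) (Bmat p n a) m w)
    {P : (Fin p → Fin t) → ℝ} (hP : ∑ s, P s = 1) : reducedC22 p t n a P *ᵥ 1 = 0 := by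
  rw [reducedC22_mulVec, gapVec_dotProduct_one h hP, C22_mulVec_one h hP]
  by_cases h0 : gapNorm p n a = 0
  · simp [gapVec_eq_zero h h0]
  · rw [mul_assoc, inv_mul_cancel₀ h0, mul_one, neg_add_cancel]

/-- The uniform design. -/
def uniformDesign (p t : ℕ) : (Fin p → Fin t) → ℝ :=
  fun _ => (Fintype.card (Fin p → Fin t) : ℝ)⁻¹

lemma uniformDesign_pos (ht : 0 < t) (s : Fin p → Fin t) : 0 < uniformDesign p t s := by
  have : Nonempty (Fin t) := ⟨⟨0, ht⟩⟩
  exact inv_pos.2 (by exact_mod_cast Fintype.card_pos)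

lemma isDesign_uniformDesign (ht : 0 < t) : IsDesign (uniformDesign p t) := by
  have : Nonempty (Fin t) := ⟨⟨0, ht⟩⟩
  refine ⟨fun s => (uniformDesign_pos ht s).le, ?_⟩
  have : (Fintype.card (Fin p → Fin t) : ℝ) ≠ 0 := by exact_mod_cast Fintype.card_ne_zero
  unfold uniformDesign
  rw [Finset.sum_const, Finset.card_univ, nsmul_eq_mul, mul_inv_cancel₀ this]

lemma sum_apply_eq_zero {y : Fin t → ℝ} (hy : ∑ i, y i = 0) (k : Fin p) :
    ∑ s : Fin p → Fin t, y (s k) = 0 := by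
  have := Finset.prod_univ_sum (fun _ : Fin p => (Finset.univ : Finset (Fin t)))
    (fun i j => if i = k then y j else 1)
  rw [Fintype.piFinset_univ] at this
  simp only [Finset.prod_ite_eq', Finset.mem_univ, if_true] at this
  rw [← this]
  exact Finset.prod_eq_zero (Finset.mem_univ k) (by simpa using hy)

lemma Fbar_uniformDesign_mulVec {y : Fin t → ℝ} (hy : ∑ i, y i = 0) :
    Fbar (uniformDesign p t) *ᵥ y = 0 := by
  ext k
  simp only [Fbar_mulVec, Finset.sum_apply, Pi.smul_apply, Fmat_mulVec, uniformDesign,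
    ← Finset.smul_sum, Pi.zero_apply]
  by_cases hk : (k : ℕ) = 0
  · simp [hk]
  · simp only [if_neg hk, sum_apply_eq_zero hy, smul_zero]

lemma eq_zero_of_const {y : Fin t → ℝ} (hy : ∑ i, y i = 0) (hc : ∀ i j, y i = y j) : y = 0 := by
  ext i
  have h1 : ∑ j, y j = t * y i := by
    rw [Finset.sum_congr rfl fun j _ => hc j i]; simp
  have ht : (t : ℝ) ≠ 0 := by exact_mod_cast (i.pos).ne'
  exact (mul_eq_zero.1 (h1.symm.trans hy)).resolve_left ht

lemma C22_uniformDesign_quad_pos (hn : 1 ≤ n) (h : IsPeriodPair (Amat p n a) (Bmat p n a) m w)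
    {y : Fin t → ℝ} (hy : ∑ i, y i = 0) (hy0 : y ≠ 0) :
    0 < y ⬝ᵥ C22 p t n a (uniformDesign p t) *ᵥ y := by
  have ht : 0 < t := by
    obtain ⟨i, -⟩ := Function.ne_iff.1 hy0
    exact i.pos
  rw [dotProduct_C22_mulVec, Fbar_uniformDesign_mulVec hy, zero_dotProduct, sub_zero]
  refine mul_pos (by positivity) (lt_of_le_of_ne
    (Finset.sum_nonneg fun s _ => mul_nonneg (uniformDesign_pos ht s).le (h.nonneg _))
    fun h0 => hy0 (eq_zero_of_const hy ?_))
  rw [eq_comm, Finset.sum_eq_zero_iff_of_nonneg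
    fun s _ => mul_nonneg (uniformDesign_pos ht s).le (h.nonneg _)] at h0
  have h1 : ∀ s : Fin p → Fin t, Amat p n a *ᵥ (Fmat s *ᵥ y) = 0 := fun s =>
    h.left_eq_zero ((mul_eq_zero.1 (h0 s (Finset.mem_univ s))).resolve_left
      (uniformDesign_pos ht s).ne')
  exact h.const_of_row fun s s' => by rw [h1, h1]

lemma IsDesign.mix {P Q : (Fin p → Fin t) → ℝ} (hP : IsDesign P) (hQ : IsDesign Q) {l : ℝ}
    (h0 : 0 ≤ l) (h1 : l ≤ 1) : IsDesign ((1 - l) • P + l • Q) := by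
  refine ⟨fun s => add_nonneg (mul_nonneg (sub_nonneg.2 h1) (hP.1 s)) (mul_nonneg h0 (hQ.1 s)), ?_⟩
  simp only [Pi.add_apply, Pi.smul_apply, smul_eq_mul, Finset.sum_add_distrib, ← Finset.mul_sum,
    hP.2, hQ.2]
  ring

lemma continuous_reducedC22 (p t n : ℕ) (a : ℕ → ℝ) : Continuous (reducedC22 p t n a) := by
  have hF : Continuous (Fbar : ((Fin p → Fin t) → ℝ) → _) := by unfold Fbar; fun_prop
  unfold reducedC22 C22 gapVec
  fun_prop

lemma IsUnivOptimal.reducedC22_quad_nonneg (ht : 2 ≤ t) (hn : 1 ≤ n)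
    (h : IsPeriodPair (Amat p n a) (Bmat p n a) m w) {P Q : (Fin p → Fin t) → ℝ}
    (hopt : IsUnivOptimal p t n a P) (hQ : IsDesign Q) (x : Fin t → ℝ) :
    0 ≤ x ⬝ᵥ reducedC22 p t n a Q *ᵥ x := by
  have ht0 : 0 < t := by omega
  have : Nonempty (Fin t) := ⟨⟨0, ht0⟩⟩
  by_contra! hneg
  let q : ℝ → (Fin p → Fin t) → ℝ := fun l => (1 - l) • Q + l • uniformDesign p t
  have hsum : ∀ l, ∑ s, q l s = 1 := fun l => by
    simp only [q, Pi.add_apply, Pi.smul_apply, smul_eq_mul, Finset.sum_add_distrib,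
      ← Finset.mul_sum, hQ.2, (isDesign_uniformDesign ht0).2]
    ring
  have hq1 : q 1 = uniformDesign p t := by simp [q]
  obtain ⟨l, hl0, hl1, y, hy, hy0, hKy⟩ := exists_contrast_mem_ker
    (K := fun l => reducedC22 p t n a (q l))
    ((continuous_reducedC22 p t n a).comp (by fun_prop))
    (fun l => reducedC22_transpose h _) (fun l => reducedC22_mulVec_one h (hsum l))
    (x := x) (by simpa [q] using hneg) (fun y hy hy0 => by
      rw [hq1, reducedC22_mulVec, gapVec_dotProduct h, Fbar_uniformDesign_mulVec hy, mulVec_zero,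
        dotProduct_zero, mul_zero, zero_smul, add_zero]
      exact C22_uniformDesign_quad_pos hn h hy hy0)
  have hql : IsDesign (q l) := hQ.mix (isDesign_uniformDesign ht0) hl0.le hl1
  have hfull : ∀ s, 0 < q l s := fun s =>
    add_pos_of_nonneg_of_pos (mul_nonneg (sub_nonneg.2 hl1) (hQ.1 s))
      (mul_pos hl0 (uniformDesign_pos ht0 s))
  set c := (gapNorm p n a)⁻¹ * (gapVec p t n a (q l) ⬝ᵥ y)
  have hu : C22 p t n a (q l) *ᵥ (y - c • 1) = 0 := by
    rw [mulVec_sub, mulVec_smul, C22_mulVec_one h hql.2, ← hKy, reducedC22_mulVec, smul_neg,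
      sub_neg_eq_add, smul_smul]
    congr 2
    ring
  have hconst := hopt.const_of_ker ht hn h hql hfull hu
  exact hy0 (eq_zero_of_const hy fun i j => by simpa using hconst i j)

lemma IsUnivOptimal.C22_quad_nonneg (ht : 2 ≤ t) (hn : 1 ≤ n)
    (h : IsPeriodPair (Amat p n a) (Bmat p n a) m w) {P Q : (Fin p → Fin t) → ℝ}
    (hopt : IsUnivOptimal p t n a P) (hQ : IsDesign Q) {x : Fin t → ℝ}
    (hx : 1 ⬝ᵥ C22 p t n a Q *ᵥ x = 0) : 0 ≤ x ⬝ᵥ C22 p t n a Q *ᵥ x := by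
  have hn0 : (n : ℝ) ≠ 0 := by positivity
  rw [one_dotProduct_C22 hQ.2, neg_eq_zero, mul_eq_zero, or_iff_right hn0] at hx
  have := hopt.reducedC22_quad_nonneg ht hn h hQ x
  rwa [reducedC22_mulVec, gapVec_dotProduct h, hx, mul_zero, zero_smul, add_zero] at this

lemma one_dotProduct_C22_eq_zero (hn : 1 ≤ n) (h : IsPeriodPair (Amat p n a) (Bmat p n a) m w)
    {P : (Fin p → Fin t) → ℝ} (hP : ∑ s, P s = 1)
    (h0 : (1 : Fin t → ℝ) ⬝ᵥ C22 p t n a P *ᵥ 1 = 0) (x : Fin t → ℝ) :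
    1 ⬝ᵥ C22 p t n a P *ᵥ x = 0 := by
  have hn0 : (n : ℝ) ≠ 0 := by positivity
  rw [one_dotProduct_C22 hP, Fbar_mulVec_one hP, neg_eq_zero, mul_eq_zero, or_iff_right hn0] at h0
  rw [one_dotProduct_C22 hP, dotProduct_mulVec_symm, h.symm_gap, h.gap_eq_zero h0,
    dotProduct_zero, mul_zero, neg_zero]

end Definiteness

section CriterionValue

variable {p t n : ℕ} {a : ℕ → ℝ} {m : Fin p} {w : ℝ}

/-- The `i`-th column of `B_t`. -/
def contrast (i : Fin t) : Fin t → ℝ := center (Pi.single i 1)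

lemma sum_contrast (i : Fin t) : ∑ j, contrast i j = 0 := by
  have : Nonempty (Fin t) := ⟨i⟩
  exact sum_center _

lemma center_of_sum_eq_zero {x : Fin t → ℝ} (hx : ∑ i, x i = 0) : center x = x := by
  simp [center, hx]

lemma center_center (x : Fin t → ℝ) : center (center x) = center x := by
  rcases isEmpty_or_nonempty (Fin t) with h | h
  · exact Subsingleton.elim _ _
  · exact center_of_sum_eq_zero (sum_center x)

lemma contrast_dotProduct_self (i : Fin t) : contrast i ⬝ᵥ contrast i = 1 - (t : ℝ)⁻¹ := by
  have h : contrast i ⬝ᵥ contrast i = (Pi.single i 1 - (t : ℝ)⁻¹ • 1) ⬝ᵥ contrast i := by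
    simp [contrast, center]
  have h1 : (1 : Fin t → ℝ) ⬝ᵥ contrast i = 0 := by rw [one_dotProduct, sum_contrast]
  rw [h, sub_dotProduct, smul_dotProduct, h1, single_one_dotProduct]
  simp [contrast, center]

lemma sum_contrast_dotProduct_self (ht : 0 < t) :
    ∑ i : Fin t, contrast i ⬝ᵥ contrast i = (t : ℝ) - 1 := by
  have : (t : ℝ) ≠ 0 := by exact_mod_cast ht.ne'
  simp only [contrast_dotProduct_self, Finset.sum_const, Finset.card_univ, Fintype.card_fin,
    nsmul_eq_mul]
  field_simp

lemma trace_eq_sum_contrast {C : Matrix (Fin t) (Fin t) ℝ} (hC : Cᵀ = C) (h1 : C *ᵥ 1 = 0) :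
    C.trace = ∑ i, contrast i ⬝ᵥ C *ᵥ contrast i := by
  simp only [contrast, quad_center hC h1, mulVec_single_one, single_one_dotProduct]
  rfl

lemma trace_Bsq_conj (X Y : Matrix (Fin p) (Fin t) ℝ) (M : Matrix (Fin p) (Fin p) ℝ) :
    (Bsq t * Xᵀ * M * Y * Bsq t).trace =
      ∑ i, (X *ᵥ contrast i) ⬝ᵥ M *ᵥ (Y *ᵥ contrast i) := by
  have h : Bsq t * Xᵀ * M * Y * Bsq t = (X * Bsq t)ᵀ * M * (Y * Bsq t) := by
    rw [transpose_mul, Bsq_transpose]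
    simp only [Matrix.mul_assoc]
  rw [h, Matrix.trace]
  refine Finset.sum_congr rfl fun i _ => ?_
  rw [contrast, ← mul_Bsq_mulVec, ← mul_Bsq_mulVec, ← dotProduct_transpose_mul_mul_mulVec,
    mulVec_single_one, single_one_dotProduct]
  rfl

lemma qfun_eq (h : IsPeriodPair (Amat p n a) (Bmat p n a) m w) (s : Fin p → Fin t) (x : ℝ) :
    qfun p t n a s x = ∑ i, response s (contrast i) (x • contrast i) ⬝ᵥ
      Amat p n a *ᵥ response s (contrast i) (x • contrast i) := by
  rw [qfun, q11, q12, q22, trace_Bsq_conj, trace_Bsq_conj, trace_Bsq_conj]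
  simp only [response, quad_add h.symm_left, mulVec_smul, smul_dotProduct, dotProduct_smul,
    smul_eq_mul, Finset.sum_add_distrib, ← Finset.mul_sum]
  ring

lemma qfun_nonneg (h : IsPeriodPair (Amat p n a) (Bmat p n a) m w) (s : Fin p → Fin t) (x : ℝ) :
    0 ≤ qfun p t n a s x := by
  rw [qfun_eq h]
  exact Finset.sum_nonneg fun i _ => h.nonneg _

lemma sum_qfun_eq (P : (Fin p → Fin t) → ℝ) (x : ℝ) :
    ∑ s, P s * qfun p t n a s x = ∑ s, P s * q11 p t n a s
      + (2 * ∑ s, P s * q12 p t n a s) * x + (∑ s, P s * q22 p t n a s) * x ^ 2 := by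
  simp only [qfun, mul_add, Finset.sum_add_distrib, Finset.sum_mul, Finset.mul_sum]
  congr 1
  · congr 1
    exact Finset.sum_congr rfl fun s _ => by ring
  · exact Finset.sum_congr rfl fun s _ => by ring

lemma sum_qfun_nonneg (h : IsPeriodPair (Amat p n a) (Bmat p n a) m w)
    {P : (Fin p → Fin t) → ℝ} (hP : IsDesign P) (x : ℝ) :
    0 ≤ ∑ s, P s * qfun p t n a s x :=
  Finset.sum_nonneg fun s _ => mul_nonneg (hP.1 s) (qfun_nonneg h s x)

lemma q22_nonneg (h : IsPeriodPair (Amat p n a) (Bmat p n a) m w) (s : Fin p → Fin t) :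
    0 ≤ q22 p t n a s := by
  rw [q22, trace_Bsq_conj]
  exact Finset.sum_nonneg fun i _ => h.nonneg _

lemma qmin_le (h : IsPeriodPair (Amat p n a) (Bmat p n a) m w)
    {P : (Fin p → Fin t) → ℝ} (hP : IsDesign P) (x : ℝ) :
    qmin p t n a P ≤ ∑ s, P s * qfun p t n a s x :=
  csInf_le ⟨0, by rintro _ ⟨y, rfl⟩; exact sum_qfun_nonneg h hP y⟩ ⟨x, rfl⟩

lemma exists_sum_qfun_eq_qmin (h : IsPeriodPair (Amat p n a) (Bmat p n a) m w)
    {P : (Fin p → Fin t) → ℝ} (hP : IsDesign P) :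
    ∃ x, ∑ s, P s * qfun p t n a s x = qmin p t n a P := by
  have := exists_quadratic_eq_sInf (c0 := ∑ s, P s * q11 p t n a s)
    (c1 := 2 * ∑ s, P s * q12 p t n a s) (c2 := ∑ s, P s * q22 p t n a s)
    (Finset.sum_nonneg fun s _ => mul_nonneg (hP.1 s) (q22_nonneg h s))
    (fun x => by rw [← sum_qfun_eq]; exact sum_qfun_nonneg h hP x)
  simpa only [qmin, sum_qfun_eq] using this

lemma IsDesign.le_one {P : (Fin p → Fin t) → ℝ} (hP : IsDesign P) (s : Fin p → Fin t) :
    P s ≤ 1 :=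
  hP.2 ▸ Finset.single_le_sum (fun r _ => hP.1 r) (Finset.mem_univ s)

lemma qmin_le_ystar (h : IsPeriodPair (Amat p n a) (Bmat p n a) m w)
    {P : (Fin p → Fin t) → ℝ} (hP : IsDesign P) : qmin p t n a P ≤ ystar p t n a := by
  refine le_csSup ⟨∑ s : Fin p → Fin t, qfun p t n a s 0, ?_⟩ ⟨P, hP, rfl⟩
  rintro _ ⟨Q, hQ, rfl⟩
  refine (qmin_le h hQ 0).trans (Finset.sum_le_sum fun s _ => ?_)
  exact mul_le_of_le_one_left (qfun_nonneg h s 0) (hQ.le_one s)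

end CriterionValue

section Symmetric

variable {p t n : ℕ} {a : ℕ → ℝ} {m : Fin p} {w : ℝ}

lemma Tmat_perm (σ : Equiv.Perm (Fin t)) (s : Fin p → Fin t) (k : Fin p) (i : Fin t) :
    Tmat (fun k => σ (s k)) k (σ i) = Tmat s k i := by
  simp [Tmat]

lemma Fmat_perm (σ : Equiv.Perm (Fin t)) (s : Fin p → Fin t) (k : Fin p) (i : Fin t) :
    Fmat (fun k => σ (s k)) k (σ i) = Fmat s k i := by
  simp [Fmat]

/-- Relabelling treatments as a permutation of treatment sequences. -/
def relabel (p : ℕ) (σ : Equiv.Perm (Fin t)) : Equiv.Perm (Fin p → Fin t) :=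
  Equiv.arrowCongr (Equiv.refl _) σ

lemma exists_perm_apply_eq {i₀ j₀ i j : Fin t} (h₀ : i₀ ≠ j₀) (h : i ≠ j) :
    ∃ σ : Equiv.Perm (Fin t), σ i₀ = i ∧ σ j₀ = j := by
  let τ := Equiv.swap i₀ i
  have hτ : τ i₀ = i := Equiv.swap_apply_left _ _
  have hne : i ≠ τ j₀ := fun he => h₀ (τ.injective (hτ.trans he))
  refine ⟨Equiv.swap (τ j₀) j * τ, ?_, ?_⟩
  · rw [Equiv.Perm.mul_apply, hτ, Equiv.swap_apply_of_ne_of_ne hne h]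
  · rw [Equiv.Perm.mul_apply, Equiv.swap_apply_left]

/-- A matrix invariant under relabelling acts on contrasts as a scalar. -/
lemma exists_scalar_of_perm_invariant (ht : 2 ≤ t) {H : Matrix (Fin t) (Fin t) ℝ}
    (hH : ∀ (σ : Equiv.Perm (Fin t)) i j, H (σ i) (σ j) = H i j) :
    ∃ α : ℝ, ∀ v w : Fin t → ℝ, ∑ i, v i = 0 → v ⬝ᵥ H *ᵥ w = α * (v ⬝ᵥ w) := by
  have : Nontrivial (Fin t) := Fin.nontrivial_iff_two_le.2 ht
  obtain ⟨i₀, j₀, h₀⟩ := exists_pair_ne (Fin t)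
  refine ⟨H i₀ i₀ - H i₀ j₀, fun v w hv => ?_⟩
  have key : ∀ i j, H i j = (H i₀ i₀ - H i₀ j₀) * (if i = j then 1 else 0) + H i₀ j₀ := by
    intro i j
    by_cases hij : i = j
    · subst hij
      have := hH (Equiv.swap i₀ i) i₀ i₀
      rw [Equiv.swap_apply_left] at this
      simp [this]
    · obtain ⟨σ, rfl, rfl⟩ := exists_perm_apply_eq h₀ hij
      simp [hH, hij]
  generalize H i₀ i₀ - H i₀ j₀ = α at key ⊢
  generalize H i₀ j₀ = β at key
  have h1 : H *ᵥ w = α • w + (β * ∑ j, w j) • 1 := by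
    ext i
    simp [mulVec, dotProduct, key, add_mul, Finset.sum_add_distrib, Finset.mul_sum]
  rw [h1, dotProduct_add, dotProduct_smul, dotProduct_smul, dotProduct_one, hv, smul_zero, add_zero,
    smul_eq_mul]

lemma IsSymmetricDesign.sum_smul_relabel {E : Type*} [AddCommGroup E] [Module ℝ E]
    {Q : (Fin p → Fin t) → ℝ} (hs : IsSymmetricDesign Q) (σ : Equiv.Perm (Fin t))
    (g : (Fin p → Fin t) → E) : ∑ s, Q s • g (relabel p σ s) = ∑ s, Q s • g s := by
  rw [← Equiv.sum_comp (relabel p σ) fun s => Q s • g s]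
  exact Finset.sum_congr rfl fun s _ => congrArg (· • g _) (hs σ s).symm

lemma IsSymmetricDesign.exists_scalar (ht : 2 ≤ t) {Q : (Fin p → Fin t) → ℝ}
    (hs : IsSymmetricDesign Q) {X Y : (Fin p → Fin t) → Matrix (Fin p) (Fin t) ℝ}
    (hX : ∀ (σ : Equiv.Perm (Fin t)) s k i, X (relabel p σ s) k (σ i) = X s k i)
    (hY : ∀ (σ : Equiv.Perm (Fin t)) s k i, Y (relabel p σ s) k (σ i) = Y s k i)
    (M : Matrix (Fin p) (Fin p) ℝ) :
    ∃ α : ℝ, ∀ v w : Fin t → ℝ, ∑ i, v i = 0 →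
      ∑ s, Q s * ((X s *ᵥ v) ⬝ᵥ M *ᵥ (Y s *ᵥ w)) = α * (v ⬝ᵥ w) := by
  obtain ⟨α, hα⟩ := exists_scalar_of_perm_invariant ht
    (H := ∑ s, Q s • ((X s)ᵀ * M * Y s)) (fun σ i j => by
      conv_lhs => rw [← hs.sum_smul_relabel σ]
      simp only [Matrix.sum_apply, Matrix.smul_apply, Matrix.mul_apply, transpose_apply, hX, hY])
  refine ⟨α, fun v w hv => ?_⟩
  simpa only [dotProduct_sum_smul_mulVec, dotProduct_transpose_mul_mul_mulVec] using hα v w hv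

lemma IsSymmetricDesign.mean_mulVec_eq_zero {Q : (Fin p → Fin t) → ℝ}
    (hs : IsSymmetricDesign Q) {X : (Fin p → Fin t) → Matrix (Fin p) (Fin t) ℝ}
    (hX : ∀ (σ : Equiv.Perm (Fin t)) s k i, X (relabel p σ s) k (σ i) = X s k i)
    {v : Fin t → ℝ} (hv : ∑ i, v i = 0) : (∑ s, Q s • X s) *ᵥ v = 0 := by
  ext k
  have hc : ∀ i j, (∑ s, Q s • X s) k i = (∑ s, Q s • X s) k j := fun i j => by
    conv_lhs => rw [← hs.sum_smul_relabel (Equiv.swap i j) X]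
    simp only [Matrix.sum_apply, Matrix.smul_apply]
    refine Finset.sum_congr rfl fun s _ => ?_
    have := hX (Equiv.swap i j) s k j
    rw [Equiv.swap_apply_right] at this
    rw [this]
  rw [mulVec, dotProduct, Pi.zero_apply]
  rcases isEmpty_or_nonempty (Fin t) with h | ⟨⟨i₀⟩⟩
  · simp
  · rw [Finset.sum_congr rfl fun i _ => by rw [hc i i₀], ← Finset.mul_sum, hv, mul_zero]

end Symmetric

section LowerBound

variable {p t n : ℕ} {a : ℕ → ℝ} {m : Fin p} {w : ℝ}

lemma sum_mul_quad_add {M : Matrix (Fin p) (Fin p) ℝ} (hM : Mᵀ = M) {P : (Fin p → Fin t) → ℝ}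
    (hP : ∑ s, P s = 1) (z : (Fin p → Fin t) → Fin p → ℝ) (y : Fin p → ℝ) :
    ∑ s, P s * ((z s + y) ⬝ᵥ M *ᵥ (z s + y)) =
      ∑ s, P s * (z s ⬝ᵥ M *ᵥ z s) + 2 * ((∑ s, P s • z s) ⬝ᵥ M *ᵥ y) + y ⬝ᵥ M *ᵥ y := by
  simp only [quad_add hM, mul_add, Finset.sum_add_distrib, ← Finset.sum_mul, hP, one_mul,
    sum_dotProduct, smul_dotProduct, smul_eq_mul, mul_left_comm _ (2 : ℝ), ← Finset.mul_sum]

lemma eq_center_add (x : Fin t → ℝ) : x = center x + ((∑ i, x i) / t) • 1 := by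
  simp [center]

lemma IsSymmetricDesign.Tbar_mulVec_eq_zero {Q : (Fin p → Fin t) → ℝ}
    (hs : IsSymmetricDesign Q) {v : Fin t → ℝ} (hv : ∑ i, v i = 0) : Tbar Q *ᵥ v = 0 :=
  hs.mean_mulVec_eq_zero Tmat_perm hv

lemma IsSymmetricDesign.Fbar_mulVec_eq_zero {Q : (Fin p → Fin t) → ℝ}
    (hs : IsSymmetricDesign Q) {v : Fin t → ℝ} (hv : ∑ i, v i = 0) : Fbar Q *ᵥ v = 0 :=
  hs.mean_mulVec_eq_zero Fmat_perm hv

lemma IsSymmetricDesign.qmin_mul_le (ht : 2 ≤ t) (h : IsPeriodPair (Amat p n a) (Bmat p n a) m w)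
    {Q : (Fin p → Fin t) → ℝ} (hs : IsSymmetricDesign Q) (hQ : IsDesign Q) {v u : Fin t → ℝ}
    (hv : ∑ i, v i = 0) (hu : ∑ i, u i = 0) :
    qmin p t n a Q * (v ⬝ᵥ v) ≤
      (t - 1) * ∑ s, Q s * (response s v u ⬝ᵥ Amat p n a *ᵥ response s v u) := by
  obtain ⟨α, hα⟩ := hs.exists_scalar ht Tmat_perm Tmat_perm (Amat p n a)
  obtain ⟨β, hβ⟩ := hs.exists_scalar ht Tmat_perm Fmat_perm (Amat p n a)
  obtain ⟨γ, hγ⟩ := hs.exists_scalar ht Fmat_perm Fmat_perm (Amat p n a)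
  have ht1 : (2 : ℝ) ≤ t := by exact_mod_cast ht
  have key : ∀ v u : Fin t → ℝ, ∑ i, v i = 0 → ∑ i, u i = 0 →
      ∑ s, Q s * (response s v u ⬝ᵥ Amat p n a *ᵥ response s v u) =
        α * (v ⬝ᵥ v) + 2 * (β * (v ⬝ᵥ u)) + γ * (u ⬝ᵥ u) := fun v u hv hu => by
    simp only [response, quad_add h.symm_left, mul_add, Finset.sum_add_distrib,
      mul_left_comm _ (2 : ℝ), ← Finset.mul_sum, hα v v hv, hβ v u hv, hγ u u hu]
  have hq : ∀ x, ∑ s, Q s * qfun p t n a s x = (t - 1) * (α + 2 * β * x + γ * x ^ 2) := by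
    intro x
    simp only [qfun_eq h, Finset.mul_sum]
    rw [Finset.sum_comm, ← sum_contrast_dotProduct_self (by omega), Finset.sum_mul]
    refine Finset.sum_congr rfl fun i _ => ?_
    rw [key _ _ (sum_contrast i) (by
      simp only [Pi.smul_apply, ← Finset.smul_sum, sum_contrast, smul_zero])]
    simp only [dotProduct_smul, smul_dotProduct, smul_eq_mul]
    ring
  have hγ0 : 0 ≤ γ := by
    have i : Fin t := ⟨0, by omega⟩
    have h1 := hγ (contrast i) (contrast i) (sum_contrast i)
    have h2 : 0 ≤ γ * (contrast i ⬝ᵥ contrast i) := by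
      rw [← h1]
      exact Finset.sum_nonneg fun s _ => mul_nonneg (hQ.1 s) (h.nonneg _)
    refine nonneg_of_mul_nonneg_left h2 ?_
    rw [contrast_dotProduct_self, sub_pos]
    exact inv_lt_one_of_one_lt₀ (by linarith)
  have huu : 0 ≤ u ⬝ᵥ u := by simpa using dotProduct_star_self_nonneg u
  rw [key v u hv hu]
  rcases (show 0 ≤ v ⬝ᵥ v by simpa using dotProduct_star_self_nonneg v).eq_or_lt with h0 | h0
  · have hv0 : v = 0 := dotProduct_self_eq_zero.1 h0.symm
    subst hv0
    simp only [zero_dotProduct, mul_zero, zero_add]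
    exact mul_nonneg (by linarith) (mul_nonneg hγ0 huu)
  · set x := (v ⬝ᵥ u) / (v ⬝ᵥ v) with hx
    have hvu : v ⬝ᵥ u = x * (v ⬝ᵥ v) := by rw [hx, div_mul_cancel₀ _ h0.ne']
    have hcs : x ^ 2 * (v ⬝ᵥ v) ≤ u ⬝ᵥ u := by
      have h1 : 0 ≤ (u - x • v) ⬝ᵥ (u - x • v) := by
        simpa using dotProduct_star_self_nonneg (u - x • v)
      simp only [sub_dotProduct, dotProduct_sub, smul_dotProduct, dotProduct_smul, smul_eq_mul,
        dotProduct_comm u v, hvu] at h1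
      linarith
    have h2 := (qmin_le h hQ x).trans_eq (hq x)
    have h3 := mul_le_mul_of_nonneg_right h2 h0.le
    have h4 := mul_le_mul_of_nonneg_left hcs (mul_nonneg (show (0 : ℝ) ≤ t - 1 by linarith) hγ0)
    rw [hvu]
    linarith

lemma IsSymmetricDesign.qmin_mul_le_quad_CInfo (ht : 2 ≤ t) (hn : 1 ≤ n)
    (h : IsPeriodPair (Amat p n a) (Bmat p n a) m w)
    {Q : (Fin p → Fin t) → ℝ} (hs : IsSymmetricDesign Q) (hQ : IsDesign Q)
    (hker : ∀ u, C22 p t n a Q *ᵥ u = 0 → C12 p t n a Q *ᵥ u = 0)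
    {W : Matrix (Fin t) (Fin t) ℝ} (hW : IsGInv (C22 p t n a Q) W) {v : Fin t → ℝ}
    (hv : ∑ i, v i = 0) :
    n * (qmin p t n a Q * (v ⬝ᵥ v)) ≤ (t - 1) * (v ⬝ᵥ CInfo p t n a Q W *ᵥ v) := by
  have : Nonempty (Fin t) := ⟨⟨0, by omega⟩⟩
  have hn0 : (n : ℝ) ≠ 0 := by positivity
  set u : Fin t → ℝ := -(W *ᵥ (C12 p t n a Q)ᵀ *ᵥ v) with hu
  set c : ℝ := (∑ i, u i) / t
  have huc : u = center u + c • 1 := eq_center_add u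
  have hFu : Fbar Q *ᵥ u = c • laterOnes p := by
    rw [huc, mulVec_add, mulVec_smul, hs.Fbar_mulVec_eq_zero (sum_center u),
      Fbar_mulVec_one hQ.2, zero_add]
  have hC22u : C22 p t n a Q *ᵥ u = -((C12 p t n a Q)ᵀ *ᵥ v) := by
    rw [hu, mulVec_neg, mulVec_mulVec, mulVec_mulVec,
      mul_transpose_eq_of_ker_le (C22_transpose h Q) hker hW]
  have hc : c * gapNorm p n a = 0 := by
    have h1 := one_dotProduct_C22 (n := n) (a := a) hQ.2 u
    have h2 : v ⬝ᵥ C12 p t n a Q *ᵥ 1 = 0 := by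
      rw [dotProduct_C12_mulVec, hs.Tbar_mulVec_eq_zero hv]
      simp only [Fmat_mulVec_one, zero_dotProduct, sub_zero]
      have h3 : ∑ s, Q s * ((Tmat s *ᵥ v) ⬝ᵥ Amat p n a *ᵥ laterOnes p) =
          (Tbar Q *ᵥ v) ⬝ᵥ Amat p n a *ᵥ laterOnes p := by
        simp only [Tbar_mulVec, sum_dotProduct, smul_dotProduct, smul_eq_mul]
      rw [h3, hs.Tbar_mulVec_eq_zero hv, zero_dotProduct, mul_zero]
    rw [hC22u, dotProduct_neg, ← dotProduct_mulVec_symm, h2, neg_zero, hFu, mulVec_smul,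
      dotProduct_smul, smul_eq_mul, eq_comm, neg_eq_zero, mul_eq_zero, or_iff_right hn0] at h1
    exact h1
  have hblock := block_quad_eq_schur (Y := C11 p t n a Q) (C22_transpose h Q) hker hW v u
  rw [show u + W *ᵥ (C12 p t n a Q)ᵀ *ᵥ v = 0 by rw [hu, neg_add_cancel], zero_dotProduct,
    add_zero, block_quad_eq h] at hblock
  have hmean : meanResponse Q v (center u) = 0 := by
    rw [meanResponse, hs.Tbar_mulVec_eq_zero hv, hs.Fbar_mulVec_eq_zero (sum_center u), add_zero]
  have hsum : ∑ s, Q s * (response s v u ⬝ᵥ Amat p n a *ᵥ response s v u)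
        - meanResponse Q v u ⬝ᵥ Bmat p n a *ᵥ meanResponse Q v u =
      ∑ s, Q s * (response s v (center u) ⬝ᵥ Amat p n a *ᵥ response s v (center u)) := by
    rw [huc]
    simp only [response_add_const, meanResponse_add_const hQ.2]
    rw [← huc, sum_mul_quad_add h.symm_left hQ.2, ← meanResponse_eq, hmean, zero_dotProduct,
      zero_add, quad_smul, quad_smul]
    rw [gapNorm, sub_mulVec, dotProduct_sub] at hc
    linear_combination -c * hc
  rw [CInfo, ← hblock, hsum]
  have := mul_le_mul_of_nonneg_left (hs.qmin_mul_le ht h hQ hv (sum_center u))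
    (Nat.cast_nonneg (α := ℝ) n)
  linarith

end LowerBound

section Symmetrization

variable {p t n : ℕ} {a : ℕ → ℝ} {m : Fin p} {w : ℝ}

/-- The average of a design over all relabellings of the treatments. -/
def symmetrize (Q : (Fin p → Fin t) → ℝ) : (Fin p → Fin t) → ℝ :=
  fun s => (Fintype.card (Equiv.Perm (Fin t)) : ℝ)⁻¹ * ∑ σ, Q (relabel p σ s)

lemma isSymmetricDesign_symmetrize (Q : (Fin p → Fin t) → ℝ) :
    IsSymmetricDesign (symmetrize Q) := fun σ s =>
  congrArg (_ * ·) (Equiv.sum_comp (Equiv.mulRight σ) fun τ => Q (relabel p τ s))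

lemma sum_symmetrize_mul (Q f : (Fin p → Fin t) → ℝ)
    (hf : ∀ σ s, f (relabel p σ s) = f s) :
    ∑ s, symmetrize Q s * f s = ∑ s, Q s * f s := by
  have hc : (Fintype.card (Equiv.Perm (Fin t)) : ℝ) ≠ 0 := by exact_mod_cast Fintype.card_ne_zero
  simp only [symmetrize, mul_assoc, ← Finset.mul_sum, Finset.sum_mul]
  rw [Finset.sum_comm, inv_mul_eq_iff_eq_mul₀ hc, ← nsmul_eq_mul, ← Finset.card_univ,
    ← Finset.sum_const]
  refine Finset.sum_congr rfl fun σ _ => ?_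
  rw [← Equiv.sum_comp (relabel p σ) fun s => Q s * f s]
  simp only [hf]

lemma isDesign_symmetrize {Q : (Fin p → Fin t) → ℝ} (hQ : IsDesign Q) :
    IsDesign (symmetrize Q) :=
  ⟨fun s => mul_nonneg (by positivity) (Finset.sum_nonneg fun σ _ => hQ.1 _), by
    simpa [hQ.2] using sum_symmetrize_mul Q (fun _ => 1) fun _ _ => rfl⟩

lemma contrast_comp (σ : Equiv.Perm (Fin t)) (i : Fin t) :
    contrast i ∘ σ = contrast (σ.symm i) := by
  have h : (Pi.single (σ.symm i) 1 : Fin t → ℝ) = Pi.single i 1 ∘ σ := by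
    ext j
    simp [Pi.single_apply, Equiv.eq_symm_apply]
  have h' : ∑ j, ((Pi.single i 1 : Fin t → ℝ) ∘ σ) j = ∑ j, (Pi.single i 1 : Fin t → ℝ) j :=
    Equiv.sum_comp σ _
  rw [contrast, contrast, h, center, center, h']
  rfl

lemma response_relabel (σ : Equiv.Perm (Fin t)) (s : Fin p → Fin t) (v u : Fin t → ℝ) :
    response (relabel p σ s) v u = response s (v ∘ σ) (u ∘ σ) := by
  ext k
  simp only [response, Pi.add_apply, Tmat_mulVec, Fmat_mulVec]
  rfl

lemma qfun_relabel (h : IsPeriodPair (Amat p n a) (Bmat p n a) m w) (σ : Equiv.Perm (Fin t))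
    (s : Fin p → Fin t) (x : ℝ) : qfun p t n a (relabel p σ s) x = qfun p t n a s x := by
  simp only [qfun_eq h, response_relabel, Pi.smul_comp, contrast_comp]
  exact Equiv.sum_comp σ.symm fun i => response s (contrast i) (x • contrast i) ⬝ᵥ
    Amat p n a *ᵥ response s (contrast i) (x • contrast i)

lemma qmin_symmetrize (h : IsPeriodPair (Amat p n a) (Bmat p n a) m w)
    (Q : (Fin p → Fin t) → ℝ) : qmin p t n a (symmetrize Q) = qmin p t n a Q := by
  have := fun x => sum_symmetrize_mul Q (fun s => qfun p t n a s x)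
    fun σ s => qfun_relabel h σ s x
  simp only [qmin, this]

end Symmetrization

section MinEigenvalue

variable {p t n : ℕ} {a : ℕ → ℝ} {m : Fin p} {w : ℝ}

/-- The least value of a quadratic form on unit contrasts. -/
def minContrast (t : ℕ) (M : Matrix (Fin t) (Fin t) ℝ) : ℝ :=
  sInf ((fun v => v ⬝ᵥ M *ᵥ v) '' contrastSphere (Fin t))

lemma contrastSphere_nonempty (ht : 2 ≤ t) : (contrastSphere (Fin t)).Nonempty := by
  have i : Fin t := ⟨0, by omega⟩
  have h1 : contrast i ≠ 0 := fun h0 => by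
    have h2 := contrast_dotProduct_self i
    have h3 : (1 : ℝ) < t := by exact_mod_cast ht
    rw [h0, zero_dotProduct] at h2
    linarith [inv_lt_one_of_one_lt₀ h3]
  obtain ⟨r, -, hr, -⟩ := exists_smul_mem_contrastSphere (sum_contrast i) h1
  exact ⟨_, hr⟩

lemma minContrast_le (M : Matrix (Fin t) (Fin t) ℝ) {v : Fin t → ℝ}
    (hv : v ∈ contrastSphere (Fin t)) : minContrast t M ≤ v ⬝ᵥ M *ᵥ v :=
  csInf_le (isCompact_contrastSphere.image (by fun_prop)).bddBelow ⟨v, hv, rfl⟩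

lemma le_minContrast (ht : 2 ≤ t) {M : Matrix (Fin t) (Fin t) ℝ} {b : ℝ}
    (hb : ∀ v ∈ contrastSphere (Fin t), b ≤ v ⬝ᵥ M *ᵥ v) : b ≤ minContrast t M :=
  le_csInf ((contrastSphere_nonempty ht).image _) (by rintro _ ⟨v, hv, rfl⟩; exact hb v hv)

lemma minContrast_submatrix_le (ht : 2 ≤ t) (σ : Equiv.Perm (Fin t))
    (M : Matrix (Fin t) (Fin t) ℝ) : minContrast t M ≤ minContrast t (M.submatrix σ σ) := by
  refine le_minContrast ht fun v hv => ?_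
  rw [submatrix_mulVec_equiv, ← comp_equiv_symm_dotProduct]
  refine minContrast_le M ⟨?_, ?_⟩
  · exact (Equiv.sum_comp σ.symm v).trans hv.1
  · exact (Equiv.sum_comp σ.symm fun i => v i ^ 2).trans hv.2

lemma isCriterion_minContrast (ht : 2 ≤ t) : IsCriterion t (minContrast t) := by
  refine ⟨fun l h0 h1 M N _ _ => ?_, fun σ M => ?_, fun M hM b c _ hbc => ?_⟩
  · refine le_minContrast ht fun v hv => ?_
    rw [add_mulVec, dotProduct_add, smul_mulVec, smul_mulVec, dotProduct_smul, dotProduct_smul]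
    exact add_le_add (mul_le_mul_of_nonneg_left (minContrast_le M hv) h0)
      (mul_le_mul_of_nonneg_left (minContrast_le N hv) (sub_nonneg.2 h1))
  · rw [permMat_conj]
    refine le_antisymm ?_ (minContrast_submatrix_le ht σ M)
    simpa using minContrast_submatrix_le ht σ⁻¹ (M.submatrix σ σ)
  · refine le_minContrast ht fun v hv => (minContrast_le _ hv).trans ?_
    simp only [smul_mulVec, dotProduct_smul, smul_eq_mul]
    exact mul_le_mul_of_nonneg_right hbc (by simpa using hM.dotProduct_mulVec_nonneg v)

lemma IsUnivOptimal.ystar_mul_le (ht : 2 ≤ t) (hn : 1 ≤ n)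
    (h : IsPeriodPair (Amat p n a) (Bmat p n a) m w) {P : (Fin p → Fin t) → ℝ}
    (hP : IsDesign P) (hopt : IsUnivOptimal p t n a P) {W : Matrix (Fin t) (Fin t) ℝ}
    (hW : IsGInv (C22 p t n a P) W) {v : Fin t → ℝ} (hv : ∑ i, v i = 0) :
    n * ystar p t n a / (t - 1) * (v ⬝ᵥ v) ≤ v ⬝ᵥ CInfo p t n a P W *ᵥ v := by
  have ht1 : (0 : ℝ) < t - 1 := by
    have : (1 : ℝ) < t := by exact_mod_cast ht
    linarith
  have hn0 : (0 : ℝ) < n := by positivity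
  have hmin : n * ystar p t n a / (t - 1) ≤ minContrast t (CInfo p t n a P W) := by
    rw [div_le_iff₀ ht1, ← le_div_iff₀' hn0]
    refine csSup_le ⟨_, P, hP, rfl⟩ ?_
    rintro _ ⟨Q, hQ, rfl⟩
    have hQ' := isDesign_symmetrize hQ
    obtain ⟨WQ, hWQ⟩ := exists_mul_mul_self_eq (C22 p t n a (symmetrize Q))
    have h1 := hopt _ (isCriterion_minContrast ht) _ hQ' W WQ hW hWQ
    rw [le_div_iff₀' hn0, ← div_le_iff₀ ht1]
    refine (le_minContrast ht fun y hy => ?_).trans h1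
    have h2 := (isSymmetricDesign_symmetrize Q).qmin_mul_le_quad_CInfo ht hn h hQ'
      (fun _ => hopt.ker_le hQ') hWQ hy.1
    have h3 : y ⬝ᵥ y = 1 := by simpa only [dotProduct, ← sq] using hy.2
    rw [h3, mul_one, qmin_symmetrize h] at h2
    rwa [div_le_iff₀' ht1]
  rcases eq_or_ne v 0 with rfl | h0
  · simp
  · obtain ⟨r, hr, hmem, hr1⟩ := exists_smul_mem_contrastSphere hv h0
    have h4 := hmin.trans (minContrast_le _ hmem)
    rw [quad_smul] at h4
    have h5 : r ^ 2 * (v ⬝ᵥ v) = 1 := by simpa only [dotProduct, ← sq] using hr1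
    refine le_of_mul_le_mul_left ?_ (pow_pos hr 2)
    rwa [mul_left_comm, h5, mul_one]

end MinEigenvalue

section Information

variable {p t n : ℕ} {a : ℕ → ℝ} {m : Fin p} {w : ℝ}

lemma Bsq_mulVec_one (t : ℕ) : Bsq t *ᵥ 1 = 0 := by
  rw [Bsq_mulVec]
  ext i
  have : (t : ℝ) ≠ 0 := by exact_mod_cast i.pos.ne'
  simp [center, this]

lemma dotProduct_Bsq_mulVec (x : Fin t → ℝ) : x ⬝ᵥ Bsq t *ᵥ x = center x ⬝ᵥ center x := by
  rw [← quad_center (Bsq_transpose t) (Bsq_mulVec_one t), Bsq_mulVec, center_center]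

lemma trace_Bsq (ht : 0 < t) : (Bsq t).trace = t - 1 := by
  rw [trace_eq_sum_contrast (Bsq_transpose t) (Bsq_mulVec_one t),
    ← sum_contrast_dotProduct_self ht]
  simp only [Bsq_mulVec, contrast, center_center]

lemma IsUnivOptimal.CInfo_transpose (h : IsPeriodPair (Amat p n a) (Bmat p n a) m w)
    {P : (Fin p → Fin t) → ℝ} (hP : IsDesign P) (hopt : IsUnivOptimal p t n a P)
    {W : Matrix (Fin t) (Fin t) ℝ} (hW : IsGInv (C22 p t n a P) W) :
    (CInfo p t n a P W)ᵀ = CInfo p t n a P W :=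
  schur_transpose (C22_transpose h P) (C11_transpose h P) (fun _ => hopt.ker_le hP) hW

lemma CInfo_mulVec_one (h : IsPeriodPair (Amat p n a) (Bmat p n a) m w)
    {P : (Fin p → Fin t) → ℝ} (hP : ∑ s, P s = 1) (W : Matrix (Fin t) (Fin t) ℝ) :
    CInfo p t n a P W *ᵥ 1 = 0 := by
  rw [CInfo, sub_mulVec, ← mulVec_mulVec, C11_mulVec_one h hP, C12_transpose_mulVec_one h hP,
    mulVec_zero, sub_zero]

lemma IsUnivOptimal.exists_quad_CInfo_le (ht : 2 ≤ t) (hn : 1 ≤ n)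
    (h : IsPeriodPair (Amat p n a) (Bmat p n a) m w)
    {P : (Fin p → Fin t) → ℝ} (hP : IsDesign P) (hopt : IsUnivOptimal p t n a P)
    {W : Matrix (Fin t) (Fin t) ℝ} (hW : IsGInv (C22 p t n a P) W) (v u : Fin t → ℝ) :
    ∃ c : ℝ, v ⬝ᵥ CInfo p t n a P W *ᵥ v ≤
      v ⬝ᵥ C11 p t n a P *ᵥ v + 2 * (v ⬝ᵥ C12 p t n a P *ᵥ (u + c • 1))
        + (u + c • 1) ⬝ᵥ C22 p t n a P *ᵥ (u + c • 1) :=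
  exists_schur_le_block_quad (C22_transpose h P) (fun _ => hopt.ker_le hP) hW 1
    (fun _ => hopt.C22_quad_nonneg ht hn h hP)
    (fun h0 => one_dotProduct_C22_eq_zero hn h hP.2 h0) v u

lemma IsUnivOptimal.quad_CInfo_le (ht : 2 ≤ t) (hn : 1 ≤ n)
    (h : IsPeriodPair (Amat p n a) (Bmat p n a) m w)
    {P : (Fin p → Fin t) → ℝ} (hP : IsDesign P) (hopt : IsUnivOptimal p t n a P)
    {W : Matrix (Fin t) (Fin t) ℝ} (hW : IsGInv (C22 p t n a P) W) (v u : Fin t → ℝ) :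
    v ⬝ᵥ CInfo p t n a P W *ᵥ v ≤
      n * (∑ s, P s * (response s v u ⬝ᵥ Amat p n a *ᵥ response s v u)
        - meanResponse P v u ⬝ᵥ Amat p n a *ᵥ meanResponse P v u) := by
  obtain ⟨c, hc⟩ := hopt.exists_quad_CInfo_le ht hn h hP hW v u
  refine hc.trans ?_
  rw [block_quad_eq h]
  simp only [response_add_const, meanResponse_add_const hP.2]
  rw [sum_mul_quad_add h.symm_left hP.2, ← meanResponse_eq]
  refine mul_le_mul_of_nonneg_left ?_ (Nat.cast_nonneg n)
  have := h.le (meanResponse P v u + c • laterOnes p)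
  rw [quad_add h.symm_left] at this
  linarith

lemma sum_response_contrast (h : IsPeriodPair (Amat p n a) (Bmat p n a) m w)
    (P : (Fin p → Fin t) → ℝ) (x : ℝ) :
    ∑ i, ∑ s, P s * (response s (contrast i) (x • contrast i) ⬝ᵥ
      Amat p n a *ᵥ response s (contrast i) (x • contrast i)) = ∑ s, P s * qfun p t n a s x := by
  rw [Finset.sum_comm]
  simp only [qfun_eq h, Finset.mul_sum]

lemma IsUnivOptimal.mul_ystar_le_trace (ht : 2 ≤ t) (hn : 1 ≤ n)
    (h : IsPeriodPair (Amat p n a) (Bmat p n a) m w)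
    {P : (Fin p → Fin t) → ℝ} (hP : IsDesign P) (hopt : IsUnivOptimal p t n a P)
    {W : Matrix (Fin t) (Fin t) ℝ} (hW : IsGInv (C22 p t n a P) W) :
    n * ystar p t n a ≤ (CInfo p t n a P W).trace := by
  have ht1 : (t : ℝ) - 1 ≠ 0 := by
    have : (1 : ℝ) < t := by exact_mod_cast ht
    linarith
  rw [trace_eq_sum_contrast (hopt.CInfo_transpose h hP hW) (CInfo_mulVec_one h hP.2 W)]
  refine le_trans (le_of_eq ?_) (Finset.sum_le_sum fun i _ =>
    hopt.ystar_mul_le ht hn h hP hW (sum_contrast i))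
  rw [← Finset.mul_sum, sum_contrast_dotProduct_self (by omega), div_mul_cancel₀ _ ht1]

lemma IsUnivOptimal.trace_CInfo_le (ht : 2 ≤ t) (hn : 1 ≤ n)
    (h : IsPeriodPair (Amat p n a) (Bmat p n a) m w)
    {P : (Fin p → Fin t) → ℝ} (hP : IsDesign P) (hopt : IsUnivOptimal p t n a P)
    {W : Matrix (Fin t) (Fin t) ℝ} (hW : IsGInv (C22 p t n a P) W) {x : ℝ}
    (hx : ∑ s, P s * qfun p t n a s x = qmin p t n a P) :
    (CInfo p t n a P W).trace ≤ n * (ystar p t n a -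
      ∑ i, meanResponse P (contrast i) (x • contrast i) ⬝ᵥ
        Amat p n a *ᵥ meanResponse P (contrast i) (x • contrast i)) := by
  rw [trace_eq_sum_contrast (hopt.CInfo_transpose h hP hW) (CInfo_mulVec_one h hP.2 W)]
  refine (Finset.sum_le_sum fun i _ =>
    hopt.quad_CInfo_le ht hn h hP hW (contrast i) (x • contrast i)).trans ?_
  rw [← Finset.mul_sum, Finset.sum_sub_distrib, sum_response_contrast h, hx]
  exact mul_le_mul_of_nonneg_left (sub_le_sub_right (qmin_le_ystar h hP) _) (Nat.cast_nonneg n)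

lemma IsUnivOptimal.mulVec_meanResponse_eq_zero (ht : 2 ≤ t) (hn : 1 ≤ n)
    (h : IsPeriodPair (Amat p n a) (Bmat p n a) m w)
    {P : (Fin p → Fin t) → ℝ} (hP : IsDesign P) (hopt : IsUnivOptimal p t n a P) {x : ℝ}
    (hx : ∑ s, P s * qfun p t n a s x = qmin p t n a P) (i : Fin t) :
    Amat p n a *ᵥ meanResponse P (contrast i) (x • contrast i) = 0 := by
  obtain ⟨W, hW⟩ := exists_mul_mul_self_eq (C22 p t n a P)
  have hn0 : (0 : ℝ) < n := by positivity
  have h1 := le_of_mul_le_mul_left ((hopt.mul_ystar_le_trace ht hn h hP hW).trans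
    (hopt.trace_CInfo_le ht hn h hP hW hx)) hn0
  have h2 : ∀ j ∈ Finset.univ, 0 ≤ meanResponse P (contrast j) (x • contrast j) ⬝ᵥ
      Amat p n a *ᵥ meanResponse P (contrast j) (x • contrast j) := fun j _ => h.nonneg _
  have h3 := (Finset.sum_eq_zero_iff_of_nonneg h2).1
    (le_antisymm (by linarith) (Finset.sum_nonneg h2))
  exact h.left_eq_zero (h3 i (Finset.mem_univ i))

lemma IsUnivOptimal.CInfo_eq (ht : 2 ≤ t) (hn : 1 ≤ n)
    (h : IsPeriodPair (Amat p n a) (Bmat p n a) m w)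
    {P : (Fin p → Fin t) → ℝ} (hP : IsDesign P) (hopt : IsUnivOptimal p t n a P)
    {W : Matrix (Fin t) (Fin t) ℝ} (hW : IsGInv (C22 p t n a P) W) :
    CInfo p t n a P W = (n * ystar p t n a / (t - 1)) • Bsq t := by
  have : Nonempty (Fin t) := ⟨⟨0, by omega⟩⟩
  have ht1 : (t : ℝ) - 1 ≠ 0 := by
    have : (1 : ℝ) < t := by exact_mod_cast ht
    linarith
  have hT := hopt.CInfo_transpose h hP hW
  obtain ⟨x, hx⟩ := exists_sum_qfun_eq_qmin h hP
  refine eq_of_quad_le_of_trace_le (by rw [transpose_smul, Bsq_transpose]) hT (fun y => ?_) ?_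
  · rw [smul_mulVec, dotProduct_smul, dotProduct_Bsq_mulVec, smul_eq_mul,
      ← quad_center hT (CInfo_mulVec_one h hP.2 W)]
    exact hopt.ystar_mul_le ht hn h hP hW (sum_center y)
  · rw [trace_smul, trace_Bsq (by omega), smul_eq_mul, div_mul_cancel₀ _ ht1]
    refine (hopt.trace_CInfo_le ht hn h hP hW hx).trans
      (mul_le_mul_of_nonneg_left ?_ (Nat.cast_nonneg n))
    exact sub_le_self _ (Finset.sum_nonneg fun i _ => h.nonneg _)

end Information

section CenteredInformation

variable {p t n : ℕ} {a : ℕ → ℝ} {m : Fin p} {w : ℝ}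

lemma center_one (t : ℕ) : center (1 : Fin t → ℝ) = 0 := by
  rw [← Bsq_mulVec, Bsq_mulVec_one]

lemma Cc11D_mulVec_one (h : IsPeriodPair (Amat p n a) (Bmat p n a) m w)
    (P : (Fin p → Fin t) → ℝ) : Cc11D p t n a P *ᵥ 1 = 0 := by
  refine dotProduct_eq _ _ fun x => ?_
  rw [dotProduct_comm, dotProduct_Cc11D_mulVec]
  simp [Tmat_mulVec_one, center_one, sub_mulVec, h.left_one, h.right_one]

lemma Cc12D_transpose_mulVec_one (h : IsPeriodPair (Amat p n a) (Bmat p n a) m w)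
    (P : (Fin p → Fin t) → ℝ) : (Cc12D p t n a P)ᵀ *ᵥ 1 = 0 := by
  refine dotProduct_eq _ _ fun x => ?_
  have hD : ∀ y, (1 : Fin p → ℝ) ⬝ᵥ (Amat p n a - Bmat p n a) *ᵥ y = 0 := fun y => by
    rw [dotProduct_mulVec_symm, transpose_sub, h.symm_left, h.symm_right, sub_mulVec, h.left_one,
      h.right_one, sub_zero, dotProduct_zero]
  rw [dotProduct_comm, ← dotProduct_mulVec_symm, dotProduct_Cc12D_mulVec]
  simp only [Tmat_mulVec_one, hD, center_one, mulVec_zero, zero_dotProduct, add_zero, mul_zero,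
    Finset.sum_const_zero]

lemma one_dotProduct_Cc22D {P : (Fin p → Fin t) → ℝ} (hP : ∑ s, P s = 1) (x : Fin t → ℝ) :
    1 ⬝ᵥ Cc22D p t n a P *ᵥ x = 1 ⬝ᵥ C22 p t n a P *ᵥ x := by
  rw [one_dotProduct_C22 hP, dotProduct_Cc22D_mulVec]
  simp only [Fmat_mulVec_one, center_one, mulVec_zero, zero_dotProduct, add_zero, Fbar_mulVec,
    mulVec_sum, dotProduct_sum, mulVec_smul, dotProduct_smul, smul_eq_mul, sub_mulVec,
    dotProduct_sub, mul_sub, Finset.sum_sub_distrib]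
  ring

lemma one_dotProduct_C22_one {P : (Fin p → Fin t) → ℝ} (hP : ∑ s, P s = 1) :
    (1 : Fin t → ℝ) ⬝ᵥ C22 p t n a P *ᵥ 1 = -(n * gapNorm p n a) := by
  rw [one_dotProduct_C22 hP, Fbar_mulVec_one hP, gapNorm]

lemma sum_response_hat (h : IsPeriodPair (Amat p n a) (Bmat p n a) m w)
    {P : (Fin p → Fin t) → ℝ} (hP : ∑ s, P s = 1) (v u : Fin t → ℝ) (c : ℝ) :
    ∑ s, P s * (response s v (u + c • 1) ⬝ᵥ (Amat p n a - Bmat p n a) *ᵥ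
        response s v (u + c • 1) + response s v u ⬝ᵥ Bmat p n a *ᵥ response s v u) =
      ∑ s, P s * (response s v u ⬝ᵥ Amat p n a *ᵥ response s v u)
        - 2 * c * (laterOnes p ⬝ᵥ (Bmat p n a - Amat p n a) *ᵥ meanResponse P v u)
        - c ^ 2 * gapNorm p n a := by
  have hD : (Amat p n a - Bmat p n a)ᵀ = Amat p n a - Bmat p n a := by
    rw [transpose_sub, h.symm_left, h.symm_right]
  simp only [mul_add, Finset.sum_add_distrib, response_add_const]
  rw [sum_mul_quad_add hD hP, ← meanResponse_eq, quad_smul, mulVec_smul, dotProduct_smul,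
    dotProduct_mulVec_symm, hD, gapNorm]
  simp only [sub_mulVec, dotProduct_sub, mul_sub, Finset.sum_sub_distrib, smul_eq_mul]
  ring

lemma block_quad_hat_eq_add (h : IsPeriodPair (Amat p n a) (Bmat p n a) m w)
    {P : (Fin p → Fin t) → ℝ} (hP : ∑ s, P s = 1) {v : Fin t → ℝ} (hv : ∑ i, v i = 0)
    (u : Fin t → ℝ) :
    v ⬝ᵥ Cc11D p t n a P *ᵥ v + 2 * (v ⬝ᵥ Cc12D p t n a P *ᵥ u) + u ⬝ᵥ Cc22D p t n a P *ᵥ u =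
      v ⬝ᵥ C11 p t n a P *ᵥ v + 2 * (v ⬝ᵥ C12 p t n a P *ᵥ u) + u ⬝ᵥ C22 p t n a P *ᵥ u
        + n * (meanResponse P v (center u) ⬝ᵥ Bmat p n a *ᵥ meanResponse P v (center u)) := by
  rw [block_quad_hat_eq h, block_quad_eq h, center_of_sum_eq_zero hv]
  obtain ⟨c, hc⟩ : ∃ c : ℝ, u = center u + c • 1 := ⟨_, eq_center_add u⟩
  generalize center u = u₀ at hc ⊢
  subst hc
  rw [sum_response_hat h hP]
  simp only [response_add_const, meanResponse_add_const hP]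
  rw [sum_mul_quad_add h.symm_left hP, ← meanResponse_eq, quad_add h.symm_right, quad_smul,
    quad_smul, dotProduct_mulVec_symm _ (laterOnes p), h.symm_gap, gapNorm]
  simp only [sub_mulVec, dotProduct_sub, mulVec_smul, dotProduct_smul, smul_eq_mul]
  ring

lemma quad_Cc22D_eq (h : IsPeriodPair (Amat p n a) (Bmat p n a) m w) (hn : 1 ≤ n)
    {P : (Fin p → Fin t) → ℝ} (hP : ∑ s, P s = 1) {u : Fin t → ℝ} {c : ℝ}
    (hu : 1 ⬝ᵥ Cc22D p t n a P *ᵥ (u + c • 1) = 0) (hu0 : center (u + c • 1) = u) :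
    (u + c • 1) ⬝ᵥ Cc22D p t n a P *ᵥ (u + c • 1) =
      n * (∑ s, P s * ((Fmat s *ᵥ u) ⬝ᵥ Amat p n a *ᵥ (Fmat s *ᵥ u)) + c ^ 2 * gapNorm p n a) := by
  have hn0 : (n : ℝ) ≠ 0 := by positivity
  have hb := block_quad_hat_eq h P 0 (u + c • 1)
  have h0 : center (0 : Fin t → ℝ) = 0 := center_of_sum_eq_zero (by simp)
  rw [h0, hu0, sum_response_hat h hP] at hb
  simp only [zero_dotProduct, mul_zero, zero_add, response, meanResponse, mulVec_zero] at hb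
  rw [one_dotProduct_Cc22D hP, one_dotProduct_C22 hP, mulVec_add, mulVec_smul, Fbar_mulVec_one hP,
    mulVec_add, dotProduct_add, mulVec_smul, dotProduct_smul, ← gapNorm, neg_eq_zero, mul_eq_zero,
    or_iff_right hn0, smul_eq_mul] at hu
  rw [hb]
  linear_combination (-2 * n * c) * hu

lemma exists_center_add (x : Fin t → ℝ) :
    ∃ (u : Fin t → ℝ) (c : ℝ), x = u + c • 1 ∧ center (u + c • 1) = u :=
  ⟨center x, _, eq_center_add x, by rw [← eq_center_add x]⟩

lemma Cc22D_quad_nonneg (h : IsPeriodPair (Amat p n a) (Bmat p n a) m w) (hn : 1 ≤ n)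
    {P : (Fin p → Fin t) → ℝ} (hP : IsDesign P) {x : Fin t → ℝ}
    (hx : 1 ⬝ᵥ Cc22D p t n a P *ᵥ x = 0) : 0 ≤ x ⬝ᵥ Cc22D p t n a P *ᵥ x := by
  obtain ⟨u, c, rfl, hu⟩ := exists_center_add x
  rw [quad_Cc22D_eq h hn hP.2 hx hu]
  exact mul_nonneg (Nat.cast_nonneg n) (add_nonneg
    (Finset.sum_nonneg fun s _ => mul_nonneg (hP.1 s) (h.nonneg _))
    (mul_nonneg (sq_nonneg c) (h.gap_nonneg _)))

lemma Cc12D_mulVec_eq_zero (h : IsPeriodPair (Amat p n a) (Bmat p n a) m w) (hn : 1 ≤ n)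
    {P : (Fin p → Fin t) → ℝ} (hP : IsDesign P) {x : Fin t → ℝ}
    (hx : Cc22D p t n a P *ᵥ x = 0) : Cc12D p t n a P *ᵥ x = 0 := by
  obtain ⟨u, c, rfl, hu⟩ := exists_center_add x
  have hn0 : (n : ℝ) ≠ 0 := by positivity
  have hq := quad_Cc22D_eq h hn hP.2 (by rw [hx, dotProduct_zero]) hu
  have h1 : ∀ s ∈ Finset.univ, 0 ≤ P s * ((Fmat s *ᵥ u) ⬝ᵥ Amat p n a *ᵥ (Fmat s *ᵥ u)) :=
    fun s _ => mul_nonneg (hP.1 s) (h.nonneg _)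
  have h2 : 0 ≤ c ^ 2 * gapNorm p n a := mul_nonneg (sq_nonneg c) (h.gap_nonneg _)
  rw [hx, dotProduct_zero, zero_eq_mul, or_iff_right hn0,
    add_eq_zero_iff_of_nonneg (Finset.sum_nonneg h1) h2, Finset.sum_eq_zero_iff_of_nonneg h1,
    gapNorm, ← quad_smul] at hq
  have hc := h.gap_eq_zero hq.2
  rw [sub_mulVec, sub_eq_zero] at hc
  refine dotProduct_eq _ _ fun v => ?_
  rw [dotProduct_comm, dotProduct_Cc12D_mulVec, hu, zero_dotProduct]
  refine mul_eq_zero_of_right _ (Finset.sum_eq_zero fun s hs => ?_)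
  refine (mul_eq_zero.1 (hq.1 s hs)).elim (fun h0 => by rw [h0, zero_mul]) fun h0 => ?_
  have hA := h.left_eq_zero h0
  have hB := h.right_eq_zero hA
  rw [mulVec_add, mulVec_smul, Fmat_mulVec_one, mulVec_add, sub_mulVec, sub_mulVec, hA, hB, hc]
  simp

lemma CcInfo_transpose (h : IsPeriodPair (Amat p n a) (Bmat p n a) m w) (hn : 1 ≤ n)
    {P : (Fin p → Fin t) → ℝ} (hP : IsDesign P)
    {W : Matrix (Fin t) (Fin t) ℝ} (hW : IsGInv (Cc22D p t n a P) W) :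
    (CcInfo p t n a P W)ᵀ = CcInfo p t n a P W :=
  schur_transpose (Cc22D_transpose h P) (Cc11D_transpose h P)
    (fun _ => Cc12D_mulVec_eq_zero h hn hP) hW

lemma CcInfo_mulVec_one (h : IsPeriodPair (Amat p n a) (Bmat p n a) m w)
    (P : (Fin p → Fin t) → ℝ) (W : Matrix (Fin t) (Fin t) ℝ) :
    CcInfo p t n a P W *ᵥ 1 = 0 := by
  rw [CcInfo, sub_mulVec, ← mulVec_mulVec, Cc11D_mulVec_one h, Cc12D_transpose_mulVec_one h,
    mulVec_zero, sub_zero]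

lemma IsUnivOptimal.quad_CInfo_le_quad_CcInfo (ht : 2 ≤ t) (hn : 1 ≤ n)
    (h : IsPeriodPair (Amat p n a) (Bmat p n a) m w)
    {P : (Fin p → Fin t) → ℝ} (hP : IsDesign P) (hopt : IsUnivOptimal p t n a P)
    {V W : Matrix (Fin t) (Fin t) ℝ} (hV : IsGInv (C22 p t n a P) V)
    (hW : IsGInv (Cc22D p t n a P) W) {v : Fin t → ℝ} (hv : ∑ i, v i = 0) :
    v ⬝ᵥ CInfo p t n a P V *ᵥ v ≤ v ⬝ᵥ CcInfo p t n a P W *ᵥ v := by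
  set u : Fin t → ℝ := -(W *ᵥ (Cc12D p t n a P)ᵀ *ᵥ v) with hu
  obtain ⟨c, hc⟩ := hopt.exists_quad_CInfo_le ht hn h hP hV v u
  have hhat := block_quad_hat_eq_add h hP.2 hv (u + c • 1)
  rw [block_quad_eq_schur (Cc22D_transpose h P) (fun _ => Cc12D_mulVec_eq_zero h hn hP) hW,
    show u + c • 1 + W *ᵥ (Cc12D p t n a P)ᵀ *ᵥ v = c • 1 by rw [hu]; abel, quad_smul,
    one_dotProduct_Cc22D hP.2, one_dotProduct_C22_one hP.2, ← CcInfo] at hhat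
  have h1 : 0 ≤ c ^ 2 * (n * gapNorm p n a) :=
    mul_nonneg (sq_nonneg c) (mul_nonneg (Nat.cast_nonneg n) (h.gap_nonneg _))
  have h2 : ∀ y, 0 ≤ n * (y ⬝ᵥ Bmat p n a *ᵥ y) := fun y =>
    mul_nonneg (Nat.cast_nonneg n) ((h.nonneg y).trans (h.le y))
  have h3 := h2 (meanResponse P v (center (u + c • 1)))
  linarith

lemma quad_CcInfo_le (hn : 1 ≤ n) (h : IsPeriodPair (Amat p n a) (Bmat p n a) m w)
    {P : (Fin p → Fin t) → ℝ} (hP : IsDesign P) {W : Matrix (Fin t) (Fin t) ℝ}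
    (hW : IsGInv (Cc22D p t n a P) W) {v u : Fin t → ℝ} (hv : ∑ i, v i = 0)
    (hu : ∑ i, u i = 0) (hmean : Amat p n a *ᵥ meanResponse P v u = 0) :
    v ⬝ᵥ CcInfo p t n a P W *ᵥ v ≤
      n * ∑ s, P s * (response s v u ⬝ᵥ Amat p n a *ᵥ response s v u) := by
  obtain ⟨c, hc⟩ := exists_schur_le_block_quad (Y := Cc11D p t n a P) (Cc22D_transpose h P)
    (fun _ => Cc12D_mulVec_eq_zero h hn hP) hW 1 (fun _ => Cc22D_quad_nonneg h hn hP)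
    (fun h0 x => by
      rw [one_dotProduct_Cc22D hP.2] at h0 ⊢
      exact one_dotProduct_C22_eq_zero hn h hP.2 h0 x) v u
  have hcu : center (u + c • 1) = u := by
    rw [← Bsq_mulVec, mulVec_add, mulVec_smul, Bsq_mulVec_one, smul_zero, add_zero, Bsq_mulVec,
      center_of_sum_eq_zero hu]
  refine hc.trans ?_
  rw [block_quad_hat_eq h, center_of_sum_eq_zero hv, hcu, sum_response_hat h hP.2, sub_mulVec,
    hmean, h.right_eq_zero hmean, sub_zero, dotProduct_zero, mul_zero, sub_zero]
  exact mul_le_mul_of_nonneg_left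
    (sub_le_self _ (mul_nonneg (sq_nonneg c) (h.gap_nonneg _))) (Nat.cast_nonneg n)

lemma IsUnivOptimal.trace_CcInfo_le (ht : 2 ≤ t) (hn : 1 ≤ n)
    (h : IsPeriodPair (Amat p n a) (Bmat p n a) m w)
    {P : (Fin p → Fin t) → ℝ} (hP : IsDesign P) (hopt : IsUnivOptimal p t n a P)
    {W : Matrix (Fin t) (Fin t) ℝ} (hW : IsGInv (Cc22D p t n a P) W) :
    (CcInfo p t n a P W).trace ≤ n * ystar p t n a := by
  obtain ⟨x, hx⟩ := exists_sum_qfun_eq_qmin h hP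
  rw [trace_eq_sum_contrast (CcInfo_transpose h hn hP hW) (CcInfo_mulVec_one h P W)]
  refine (Finset.sum_le_sum fun i _ => quad_CcInfo_le hn h hP hW (u := x • contrast i)
    (sum_contrast i) (by simp only [Pi.smul_apply, ← Finset.smul_sum, sum_contrast, smul_zero])
    (hopt.mulVec_meanResponse_eq_zero ht hn h hP hx i)).trans ?_
  rw [← Finset.mul_sum, sum_response_contrast h, hx]
  exact mul_le_mul_of_nonneg_left (qmin_le_ystar h hP) (Nat.cast_nonneg n)

lemma IsUnivOptimal.CcInfo_eq (ht : 2 ≤ t) (hn : 1 ≤ n)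
    (h : IsPeriodPair (Amat p n a) (Bmat p n a) m w)
    {P : (Fin p → Fin t) → ℝ} (hP : IsDesign P) (hopt : IsUnivOptimal p t n a P)
    {W : Matrix (Fin t) (Fin t) ℝ} (hW : IsGInv (Cc22D p t n a P) W) :
    CcInfo p t n a P W = (n * ystar p t n a / (t - 1)) • Bsq t := by
  have : Nonempty (Fin t) := ⟨⟨0, by omega⟩⟩
  obtain ⟨V, hV⟩ := exists_mul_mul_self_eq (C22 p t n a P)
  rw [← hopt.CInfo_eq ht hn h hP hV]
  have hT := hopt.CInfo_transpose h hP hV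
  have hT' := CcInfo_transpose h hn hP hW
  refine eq_of_quad_le_of_trace_le hT hT' (fun x => ?_)
    ((hopt.trace_CcInfo_le ht hn h hP hW).trans (hopt.mul_ystar_le_trace ht hn h hP hV))
  rw [← quad_center hT (CInfo_mulVec_one h hP.2 V), ← quad_center hT' (CcInfo_mulVec_one h P W)]
  exact hopt.quad_CInfo_le_quad_CcInfo ht hn h hP hV hW (sum_center x)

end CenteredInformation

/-- Lemma 4.1: if an approximate design `P` is φ₁-universally optimal, then
`C(P) = Č(P) = n y* B_t/(t−1)`. -/
theorem univOptimal_CInfo_eq_CcInfo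
    (p t n : ℕ) (hp : 2 ≤ p) (ht : 2 ≤ t) (hn : 1 ≤ n)
    (a : ℕ → ℝ) (ha0 : ∀ k ∈ Finset.Icc 1 p, 0 ≤ a k)
    (hsum : ∑ k ∈ Finset.Icc 1 p, a k = 1)
    (hex : ∃ k ∈ Finset.Icc 2 p, 0 < a k)
    (P : (Fin p → Fin t) → ℝ) (hP : IsDesign P)
    (hopt : IsUnivOptimal p t n a P) :
    (∀ W : Matrix (Fin t) (Fin t) ℝ, IsGInv (C22 p t n a P) W →
      CInfo p t n a P W = ((n : ℝ) * ystar p t n a / ((t : ℝ) - 1)) • Bsq t) ∧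
    (∀ W : Matrix (Fin t) (Fin t) ℝ, IsGInv (Cc22D p t n a P) W →
      CcInfo p t n a P W = ((n : ℝ) * ystar p t n a / ((t : ℝ) - 1)) • Bsq t) := by
  obtain ⟨m, w, h⟩ := exists_isPeriodPair hn ha0 hsum hex
  exact ⟨fun _ hW => hopt.CInfo_eq ht hn h hP hW, fun _ hW => hopt.CcInfo_eq ht hn h hP hW⟩

end
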